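/- arXiv:2506.18891 — 5 statements merged into one kernel-verified Lean document; each statement's English description precedes it below -/
import Mathlib

section
/- Let k be a field and R = k[x_0,...,x_n]. If I ⊆ R is an ideal generated by homogeneous polynomials of degree d and h is the height of I, then the F-pure threshold of I satisfies fpt(I) ≥ h/d. -/
open MvPolynomial Filter

noncomputable section

/-- The `q`-th bracket power of an ideal: the ideal generated by `q`-th powers
of elements of `I`. -/
def frobPow {R : Type*} [CommRing R] (q : ℕ) (I : Ideal R) : Ideal R :=
  Ideal.span ((fun x => x ^ q) '' (I : Set R))

/-- The homogeneous maximal ideal of `k[x_0, …, x_n]`. -/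
def maxIdl (n : ℕ) (k : Type*) [Field k] : Ideal (MvPolynomial (Fin (n + 1)) k) :=
  Ideal.span (Set.range X)

/-- `ν_I(q) = max{r : I^r ⊄ 𝔪^{[q]}}`. -/
def nuFn {n : ℕ} {k : Type*} [Field k] (I : Ideal (MvPolynomial (Fin (n + 1)) k))
    (q : ℕ) : ℕ :=
  sSup {r : ℕ | ¬ I ^ r ≤ frobPow q (maxIdl n k)}

/-- The height of an ideal: the infimum of heights of primes containing it. -/
def idealHeight {R : Type*} [CommRing R] (I : Ideal R) : ℕ∞ :=
  ⨅ (p : PrimeSpectrum R) (_ : I ≤ p.asIdeal), Order.height p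

section Helpers

attribute [local instance] MvPolynomial.gradedAlgebra

theorem aux_mem_vars {σ L : Type*} [Field L] (f : MvPolynomial σ L) :
    f ∈ idealOfVars σ L ↔ coeff 0 f = 0 := by
  have := mem_pow_idealOfVars_iff' (σ := σ) (R := L) 1 f
  rw [pow_one] at this
  rw [this]
  constructor
  · intro h
    exact h 0 (by simp)
  · intro h x hx
    have : x = 0 := by
      rw [← Finsupp.degree_eq_zero_iff]; omega
    rw [this, h]

theorem aux_vars_maximal (σ L : Type*) [Field L] : (idealOfVars σ L).IsMaximal := by
  have h : idealOfVars σ L = RingHom.ker (constantCoeff (σ := σ) (R := L)) := by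
    ext f
    rw [aux_mem_vars, RingHom.mem_ker, constantCoeff_eq]
  rw [h]
  exact RingHom.ker_isMaximal_of_surjective _ (fun a => ⟨C a, by simp⟩)

theorem aux_homog_radical {σ L : Type*} [Field L] (J : Ideal (MvPolynomial σ L))
    (hJ : J.IsHomogeneous (homogeneousSubmodule σ L))
    (hmax : ∀ P : Ideal (MvPolynomial σ L), P.IsPrime → J ≤ P → P.IsMaximal) :
    idealOfVars σ L ≤ J.radical := by
  rw [Ideal.radical_eq_sInf]
  refine le_sInf ?_
  rintro P ⟨hJP, hP⟩
  have h1 := Ideal.IsPrime.homogeneousCore (𝒜 := homogeneousSubmodule σ L) hP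
  have h2 : J ≤ (P.homogeneousCore (homogeneousSubmodule σ L)).toIdeal := by
    rw [← hJ.toIdeal_homogeneousCore_eq_self]
    exact Ideal.homogeneousCore_mono _ hJP
  have h3 := hmax _ h1 h2
  have h4 : (P.homogeneousCore (homogeneousSubmodule σ L)).toIdeal ≤ idealOfVars σ L := by
    refine Ideal.span_le.mpr ?_
    rintro _ ⟨⟨x, i, hx⟩, hxP, rfl⟩
    change x ∈ idealOfVars σ L
    change x ∈ P at hxP
    rw [aux_mem_vars]
    by_contra hne
    have hx' : x.IsHomogeneous i := hx
    have hi : i = 0 := by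
      have := hx'.coeff_eq_zero (d := 0)
      by_contra h
      exact hne (this (by simpa using fun h' => h h'.symm))
    subst hi
    have : x = C (coeff 0 x) := by
      rw [← homogeneousComponent_zero, homogeneousComponent_eq_self hx']
    rw [this] at hxP
    apply hP.ne_top
    exact Ideal.eq_top_of_isUnit_mem _ hxP ((isUnit_iff_ne_zero.mpr hne).map C)
  have h5 := h3.eq_of_le (aux_vars_maximal σ L).ne_top h4
  rw [← h5]
  exact Ideal.toIdeal_homogeneousCore_le _ P

/-- linear form with given coefficients -/
def auxLin (m : ℕ) (L : Type*) [Field L] : (Fin m → L) →ₗ[L] MvPolynomial (Fin m) L :=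
  Fintype.linearCombination L (fun i => (X i : MvPolynomial (Fin m) L))

theorem auxLin_apply {m : ℕ} {L : Type*} [Field L] (a : Fin m → L) :
    auxLin m L a = ∑ i, a i • (X i : MvPolynomial (Fin m) L) := rfl

theorem aux_cut_one {m : ℕ} {L : Type*} [Field L] [Infinite L]
    (J : Ideal (MvPolynomial (Fin m) L)) (r : ℕ)
    (hJ : ∀ P : PrimeSpectrum (MvPolynomial (Fin m) L), J ≤ P.asIdeal →
      Order.coheight P ≤ ((r + 1 : ℕ) : ℕ∞)) :
    ∃ a : Fin m → L, ∀ P : PrimeSpectrum (MvPolynomial (Fin m) L),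
      J ⊔ Ideal.span {auxLin m L a} ≤ P.asIdeal → Order.coheight P ≤ (r : ℕ∞) := by
  classical
  have hfin : J.minimalPrimes.Finite := Ideal.finite_minimalPrimes_of_isNoetherianRing _ J
  let sub : Ideal (MvPolynomial (Fin m) L) → Subspace L (Fin m → L) :=
    fun Q => (Q.restrictScalars L).comap (auxLin m L)
  let s : Finset (Subspace L (Fin m → L)) :=
    (hfin.toFinset.filter (fun Q => sub Q ≠ ⊤)).image sub
  have hs : ⊤ ∉ s := by
    intro h
    simp only [s, Finset.mem_image, Finset.mem_filter] at h
    obtain ⟨Q, ⟨_, h1⟩, h2⟩ := h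
    exact h1 h2
  have hne := Subspace.biUnion_ne_univ_of_top_notMem hs
  obtain ⟨a, ha⟩ := (Set.ne_univ_iff_exists_notMem _).mp hne
  refine ⟨a, fun P hP => ?_⟩
  obtain ⟨Q, hQ, hQP⟩ := Ideal.exists_minimalPrimes_le (le_sup_left.trans hP)
  by_cases htop : sub Q = ⊤
  · have hmQ : idealOfVars (Fin m) L ≤ Q := by
      refine Ideal.span_le.mpr ?_
      rintro _ ⟨i, rfl⟩
      have : Pi.single i (1 : L) ∈ sub Q := by rw [htop]; trivial
      have h2 : auxLin m L (Pi.single i 1) ∈ Q := this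
      simpa [auxLin, Fintype.linearCombination_apply_single] using h2
    have hPm := (aux_vars_maximal (Fin m) L).eq_of_le P.isPrime.ne_top (hmQ.trans hQP)
    have : IsMax P := by
      intro P' hP'
      have h1 : P.asIdeal ≤ P'.asIdeal := hP'
      have h2 : P.asIdeal.IsMaximal := hPm ▸ aux_vars_maximal (Fin m) L
      exact (h2.eq_of_le P'.isPrime.ne_top h1).ge
    rw [Order.coheight_eq_zero.mpr this]
    exact zero_le
  · have haQ : auxLin m L a ∉ Q := by
      intro h
      apply ha
      simp only [Set.mem_iUnion]
      refine ⟨sub Q, ?_, h⟩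
      simp only [s, Finset.mem_image, Finset.mem_filter]
      exact ⟨Q, ⟨hfin.mem_toFinset.mpr hQ, htop⟩, rfl⟩
    have haP : auxLin m L a ∈ P.asIdeal :=
      hP (Ideal.mem_sup_right (Ideal.subset_span rfl))
    let Q' : PrimeSpectrum (MvPolynomial (Fin m) L) := ⟨Q, hQ.1.1⟩
    have hlt : Q' < P := by
      refine lt_of_le_of_ne hQP ?_
      intro h
      apply haQ
      rw [← h] at haP
      exact haP
    have h1 := Order.coheight_add_one_le hlt
    have h2 := h1.trans (hJ Q' hQ.1.2)
    push_cast at h2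
    exact (ENat.add_le_add_iff_right (by simp)).mp h2

theorem aux_cut {m : ℕ} {L : Type*} [Field L] [Infinite L] (r : ℕ) :
    ∀ (J : Ideal (MvPolynomial (Fin m) L)),
    (∀ P : PrimeSpectrum (MvPolynomial (Fin m) L), J ≤ P.asIdeal →
      Order.coheight P ≤ (r : ℕ∞)) →
    ∃ a : Fin r → Fin m → L, ∀ P : PrimeSpectrum (MvPolynomial (Fin m) L),
      J ⊔ Ideal.span (Set.range fun j => auxLin m L (a j)) ≤ P.asIdeal →
        Order.coheight P = 0 := by
  induction r with
  | zero =>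
    intro J hJ
    refine ⟨Fin.elim0, fun P hP => ?_⟩
    simpa using hJ P (le_sup_left.trans hP)
  | succ r ih =>
    intro J hJ
    obtain ⟨a, ha⟩ := aux_cut_one J r hJ
    obtain ⟨b, hb⟩ := ih _ ha
    refine ⟨Fin.cons a b, fun P hP => hb P ?_⟩
    refine le_trans ?_ hP
    refine sup_le (sup_le le_sup_left ?_) ?_
    · refine le_trans (Ideal.span_mono ?_) le_sup_right
      rintro _ rfl
      exact ⟨0, by simp⟩
    · refine le_trans (Ideal.span_mono ?_) le_sup_right
      rintro _ ⟨j, rfl⟩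
      exact ⟨j.succ, by simp⟩

/-- Linear substitution making an ideal primary to the variables. -/
theorem aux_subst {m h d : ℕ} {L : Type*} [Field L] [Infinite L] (hm : h ≤ m)
    (S : Set (MvPolynomial (Fin m) L)) (hS : ∀ f ∈ S, f.IsHomogeneous d)
    (hco : ∀ P : PrimeSpectrum (MvPolynomial (Fin m) L), Ideal.span S ≤ P.asIdeal →
      Order.coheight P ≤ ((m - h : ℕ) : ℕ∞)) :
    ∃ (w : Fin m → MvPolynomial (Fin h) L) (N : ℕ), (∀ i, (w i).IsHomogeneous 1) ∧
      idealOfVars (Fin h) L ^ N ≤ Ideal.span ((aeval w : MvPolynomial (Fin m) L →ₐ[L] _) '' S) := by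
  obtain ⟨a, ha⟩ := aux_cut (m - h) _ hco
  set J := Ideal.span S ⊔ Ideal.span (Set.range fun j => auxLin m L (a j)) with hJdef
  have hJhom : J.IsHomogeneous (homogeneousSubmodule (Fin m) L) := by
    refine Ideal.IsHomogeneous.sup (Ideal.homogeneous_span _ _ fun f hf => ⟨d, hS f hf⟩)
      (Ideal.homogeneous_span _ _ ?_)
    rintro _ ⟨j, rfl⟩
    refine ⟨1, ?_⟩
    change auxLin m L (a j) ∈ homogeneousSubmodule (Fin m) L 1
    rw [auxLin_apply]
    exact Submodule.sum_mem _ fun i _ => Submodule.smul_mem _ _ (isHomogeneous_X L i)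
  have hrad : idealOfVars (Fin m) L ≤ J.radical := by
    refine aux_homog_radical J hJhom fun P hP hJP => ?_
    have h0 := Order.coheight_eq_zero.mp (ha ⟨P, hP⟩ hJP)
    exact (PrimeSpectrum.isMax_iff (x := ⟨P, hP⟩)).mp h0
  obtain ⟨N, hN⟩ := Ideal.exists_pow_le_of_le_radical_of_fg hrad (idealOfVars_fg _ _)
  -- the kernel of the linear forms
  let A : (Fin m → L) →ₗ[L] (Fin (m - h) → L) := Matrix.mulVecLin (Matrix.of a)
  have hdim : h ≤ Module.finrank L (LinearMap.ker A) := by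
    have h1 := LinearMap.finrank_range_add_finrank_ker A
    have h2 : Module.finrank L (LinearMap.range A) ≤ m - h := by
      simpa using Submodule.finrank_le (LinearMap.range A)
    simp at h1
    omega
  let v : Fin h → Fin m → L := fun j =>
    (Module.finBasis L (LinearMap.ker A) (Fin.castLE hdim j) : Fin m → L)
  have hv : LinearIndependent L v := by
    have h1 := (Module.finBasis L (LinearMap.ker A)).linearIndependent
    have h2 := h1.map' (LinearMap.ker A).subtype (Submodule.ker_subtype _)
    exact h2.comp _ (Fin.castLE_injective hdim)
  have hvA : ∀ j i, ∑ l, a i l * v j l = 0 := by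
    intro j i
    have h1 : A (v j) = 0 := (Module.finBasis L (LinearMap.ker A) (Fin.castLE hdim j)).2
    have h2 := congrFun h1 i
    simpa [A, Matrix.mulVec, dotProduct] using h2
  let w : Fin m → MvPolynomial (Fin h) L := fun i => ∑ j, v j i • (X j : MvPolynomial (Fin h) L)
  have hwlin : ∀ b : Fin m → L, (aeval w) (auxLin m L b) =
      ∑ j, (∑ i, b i * v j i) • (X j : MvPolynomial (Fin h) L) := by
    intro b
    rw [auxLin_apply, map_sum]
    simp only [map_smul, aeval_X, w, Finset.smul_sum, smul_smul, Finset.sum_smul]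
    rw [Finset.sum_comm]
  refine ⟨w, N, ?_, ?_⟩
  · intro i
    exact Submodule.sum_mem (homogeneousSubmodule (Fin h) L 1)
      fun j _ => Submodule.smul_mem _ _ (isHomogeneous_X L j)
  · have hmap : Ideal.map (aeval w : MvPolynomial (Fin m) L →ₐ[L] MvPolynomial (Fin h) L) J ≤
        Ideal.span ((aeval w : MvPolynomial (Fin m) L →ₐ[L] _) '' S) := by
      rw [hJdef, Ideal.map_sup, Ideal.map_span, Ideal.map_span]
      refine sup_le le_rfl (Ideal.span_le.mpr ?_)
      rintro _ ⟨_, ⟨i, rfl⟩, rfl⟩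
      have : (aeval w) (auxLin m L (a i)) = 0 := by
        rw [hwlin]
        simp [hvA]
      change (aeval w) (auxLin m L (a i)) ∈ _
      rw [this]
      exact Submodule.zero_mem _
    have hvars : idealOfVars (Fin h) L ≤
        Ideal.map (aeval w : MvPolynomial (Fin m) L →ₐ[L] MvPolynomial (Fin h) L)
          (idealOfVars (Fin m) L) := by
      refine Ideal.span_le.mpr ?_
      rintro _ ⟨j, rfl⟩
      let F : (Fin h → L) →ₗ[L] (Fin m → L) := Fintype.linearCombination L v
      have hF : LinearMap.ker F = ⊥ := by
        rw [LinearMap.ker_eq_bot]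
        exact hv.fintypeLinearCombination_injective
      obtain ⟨g, hg⟩ := F.exists_leftInverse_of_injective hF
      have hgv : ∀ j', g (v j') = Pi.single j' 1 := by
        intro j'
        have h1 := LinearMap.congr_fun hg (Pi.single j' 1)
        simpa [F, Fintype.linearCombination_apply_single] using h1
      let b : Fin m → L := fun i => g (Pi.single i 1) j
      have hb : ∀ j', ∑ i, b i * v j' i = (Pi.single j' (1 : L) : Fin h → L) j := by
        intro j'
        rw [← hgv j', LinearMap.pi_apply_eq_sum_univ g (v j')]
        simp only [Finset.sum_apply, Pi.smul_apply, smul_eq_mul, b]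
        refine Finset.sum_congr rfl fun i _ => ?_
        have : (fun j => if i = j then (1 : L) else 0) = Pi.single i 1 := by
          ext i'
          simp [Pi.single_apply, eq_comm]
        rw [mul_comm, this]
      have hX : (aeval w) (auxLin m L b) = (X j : MvPolynomial (Fin h) L) := by
        rw [hwlin]
        simp only [hb]
        rw [Finset.sum_eq_single j]
        · simp
        · intro j' _ hj'
          simp [hj'.symm]
        · simp
      change X j ∈ _
      rw [← hX]
      refine Ideal.mem_map_of_mem _ ?_
      rw [auxLin_apply]
      refine Ideal.sum_mem _ fun i _ => ?_
      rw [smul_eq_C_mul]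
      exact Ideal.mul_mem_left _ _ (Ideal.subset_span ⟨i, rfl⟩)
    calc idealOfVars (Fin h) L ^ N ≤ _ := Ideal.pow_right_mono hvars N
      _ = _ := (Ideal.map_pow _ _ _).symm
      _ ≤ _ := Ideal.map_mono hN
      _ ≤ _ := hmap

theorem aux_comp {σ L : Type*} [Field L] {d : ℕ} (S : Set (MvPolynomial σ L))
    (hS : ∀ f ∈ S, f.IsHomogeneous d) (t : ℕ) (f : MvPolynomial σ L) (hf : f ∈ Ideal.span S) :
    homogeneousComponent t f ∈ Ideal.span S * idealOfVars σ L ^ (t - d) := by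
  suffices H : ∀ a : MvPolynomial σ L, homogeneousComponent t (a * f) ∈
      Ideal.span S * idealOfVars σ L ^ (t - d) by simpa using H 1
  induction hf using Submodule.span_induction with
  | zero => simp
  | add x y _ _ hx hy =>
    intro a
    rw [mul_add, map_add]
    exact Ideal.add_mem _ (hx a) (hy a)
  | smul b x _ hx =>
    intro a
    rw [smul_eq_mul, ← mul_assoc]
    exact hx (a * b)
  | mem x hx =>
    intro a
    have hx' := hS x hx
    rw [← sum_homogeneousComponent a, Finset.sum_mul, map_sum]
    refine Ideal.sum_mem _ fun i _ => ?_
    have h1 := (homogeneousComponent_isHomogeneous i a).mul hx'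
    rw [homogeneousComponent_of_mem h1]
    split_ifs with h
    · rw [mul_comm (homogeneousComponent i a) x]
      refine Ideal.mul_mem_mul (Ideal.subset_span hx) ?_
      rw [mem_pow_idealOfVars_iff']
      intro y hy
      exact (homogeneousComponent_isHomogeneous i a).coeff_eq_zero (by omega)
    · exact Ideal.zero_mem _

theorem aux_pow_le {σ L : Type*} [Field L] {d N : ℕ} (S : Set (MvPolynomial σ L))
    (hS : ∀ f ∈ S, f.IsHomogeneous d) (hN : idealOfVars σ L ^ N ≤ Ideal.span S) (s : ℕ) :
    idealOfVars σ L ^ (N + s * d) ≤ Ideal.span S ^ s := by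
  suffices H : idealOfVars σ L ^ (N + s * d) ≤ Ideal.span S ^ s * idealOfVars σ L ^ N from
    H.trans Ideal.mul_le_left
  induction s with
  | zero => simp
  | succ s ih =>
    have h1 : idealOfVars σ L ^ (N + (s + 1) * d) ≤
        Ideal.span S * idealOfVars σ L ^ (N + s * d) := by
      have ht : N + (s + 1) * d - d = N + s * d := by
        rw [Nat.succ_mul]; omega
      conv_lhs => rw [pow_idealOfVars_eq_span]
      refine Ideal.span_le.mpr ?_
      rintro _ ⟨y, hy, rfl⟩
      have hy' : y.degree = N + (s + 1) * d := hy
      have hmem : monomial y (1 : L) ∈ Ideal.span S := by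
        apply hN
        rw [monomial_mem_pow_idealOfVars_iff _ _ one_ne_zero, hy']
        omega
      have h2 := aux_comp S hS (N + (s + 1) * d) _ hmem
      rwa [ht, homogeneousComponent_eq_self (isHomogeneous_monomial _ hy')] at h2
    calc _ ≤ _ := h1
      _ ≤ Ideal.span S * (Ideal.span S ^ s * idealOfVars σ L ^ N) := Ideal.mul_mono_right ih
      _ = _ := by rw [pow_succ' (Ideal.span S) s, mul_assoc]

theorem aux_frob {σ L : Type*} [Field L] {p : ℕ} [Fact p.Prime] [CharP L p] (e : ℕ)
    (x : MvPolynomial σ L) (hx : x ∈ idealOfVars σ L) :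
    x ^ (p ^ e) ∈ Ideal.span ((fun s => monomial s (1 : L)) ''
      Set.range (fun i : σ => Finsupp.single i (p ^ e))) := by
  induction hx using Submodule.span_induction with
  | mem x hx =>
    obtain ⟨i, rfl⟩ := hx
    rw [X_pow_eq_monomial]
    exact Ideal.subset_span ⟨_, ⟨i, rfl⟩, rfl⟩
  | zero =>
    rw [zero_pow (pow_ne_zero _ (Fact.out : p.Prime).ne_zero)]
    exact Ideal.zero_mem _
  | add x y _ _ hx hy =>
    rw [add_pow_char_pow]
    exact Ideal.add_mem _ hx hy
  | smul a x _ hx =>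
    rw [smul_eq_mul, mul_pow]
    exact Ideal.mul_mem_left _ _ hx

theorem aux_not_le {h : ℕ} {L : Type*} [Field L] (q : ℕ) (hq : 0 < q) (t : ℕ)
    (ht : t ≤ h * (q - 1)) :
    ¬ idealOfVars (Fin h) L ^ t ≤ Ideal.span ((fun s => monomial s (1 : L)) ''
      Set.range (fun i : Fin h => Finsupp.single i q)) := by
  intro hle
  let y : Fin h →₀ ℕ := Finsupp.equivFunOnFinite.symm (fun _ => q - 1)
  have hy : monomial y (1 : L) ∈ idealOfVars (Fin h) L ^ t := by
    rw [monomial_mem_pow_idealOfVars_iff _ _ one_ne_zero]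
    have : y.degree = h * (q - 1) := by
      rw [Finsupp.degree_eq_sum]
      simp [y]
    omega
  have h2 := hle hy
  rw [mem_ideal_span_monomial_image] at h2
  obtain ⟨_, ⟨i, rfl⟩, h3⟩ := h2 y (by simp [mem_support_iff])
  have h4 := h3 i
  simp [y] at h4
  omega

theorem aux_coheight {m h : ℕ} {k L : Type*} [Field k] [Field L] [Algebra k L]
    [Algebra.IsIntegral k L]
    (I : Ideal (MvPolynomial (Fin m) k)) (hI : (h : ℕ∞) ≤ idealHeight I)
    (P : PrimeSpectrum (MvPolynomial (Fin m) L))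
    (hP : I.map (MvPolynomial.map (algebraMap k L)) ≤ P.asIdeal) :
    Order.coheight P + h ≤ (m : ℕ∞) := by
  let _ := MvPolynomial.algebraMvPolynomial (σ := Fin m) (R := k) (S := L)
  let F := PrimeSpectrum.comap (algebraMap (MvPolynomial (Fin m) k) (MvPolynomial (Fin m) L))
  have hF : StrictMono F := by
    intro P Q hPQ
    have h1 : P.asIdeal < Q.asIdeal := hPQ
    exact Ideal.IsIntegral.comap_lt_comap h1
  have h1 : Order.coheight P ≤ Order.coheight (F P) :=
    Order.coheight_le_coheight_apply_of_strictMono F hF P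
  have h2 : (h : ℕ∞) ≤ Order.height (F P) := by
    refine hI.trans (iInf₂_le (F P) ?_)
    exact Ideal.map_le_iff_le_comap.mp hP
  have h3 : Order.height (F P) + Order.coheight (F P) ≤ (m : ℕ∞) := by
    have hd : ringKrullDim (MvPolynomial (Fin m) k) = m := by
      rw [MvPolynomial.ringKrullDim_of_isNoetherianRing]
      simp
    rw [ringKrullDim, Order.krullDim_eq_iSup_height_add_coheight_of_nonempty] at hd
    have h4 : (⨆ a : PrimeSpectrum (MvPolynomial (Fin m) k),
        Order.height a + Order.coheight a) = (m : ℕ∞) := by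
      exact_mod_cast hd
    rw [← h4]
    exact le_iSup (fun a : PrimeSpectrum (MvPolynomial (Fin m) k) =>
        Order.height a + Order.coheight a) (F P)
  calc _ ≤ Order.coheight (F P) + Order.height (F P) := add_le_add h1 h2
    _ = _ := add_comm _ _
    _ ≤ _ := h3

theorem aux_main {n d h : ℕ} {p : ℕ} (hp : p.Prime) {k : Type*} [Field k] [CharP k p]
    (S : Set (MvPolynomial (Fin (n + 1)) k))
    (hhom : ∀ f ∈ S, f.IsHomogeneous d) (hd : 0 < d)
    (hh : idealHeight (Ideal.span S) = (h : ℕ∞)) :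
    ∃ N : ℕ, ∀ e s : ℕ, N + s * d ≤ h * (p ^ e - 1) →
      ¬ Ideal.span S ^ s ≤ frobPow (p ^ e) (maxIdl n k) := by
  have : Fact p.Prime := ⟨hp⟩
  let L := AlgebraicClosure k
  have : CharP L p := charP_of_injective_algebraMap (algebraMap k L).injective p
  let ι : MvPolynomial (Fin (n + 1)) k →+* MvPolynomial (Fin (n + 1)) L :=
    MvPolynomial.map (algebraMap k L)
  have hS' : ∀ f ∈ ι '' S, f.IsHomogeneous d := by
    rintro _ ⟨f, hf, rfl⟩
    exact (hhom f hf).map _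
  have hco : ∀ P : PrimeSpectrum (MvPolynomial (Fin (n + 1)) L),
      Ideal.span (ι '' S) ≤ P.asIdeal → Order.coheight P + h ≤ ((n + 1 : ℕ) : ℕ∞) := by
    intro P hP
    refine aux_coheight (Ideal.span S) hh.ge P ?_
    rwa [Ideal.map_span]
  have hvarsS : Ideal.span (ι '' S) ≤ idealOfVars (Fin (n + 1)) L := by
    refine Ideal.span_le.mpr fun f hf => ?_
    change f ∈ idealOfVars (Fin (n + 1)) L
    rw [aux_mem_vars]
    exact (hS' f hf).coeff_eq_zero (by simpa using hd.ne)
  have hm : h ≤ n + 1 := by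
    have h1 := hco ⟨_, (aux_vars_maximal _ L).isPrime⟩ hvarsS
    have h2 : (h : ℕ∞) ≤ ((n + 1 : ℕ) : ℕ∞) := le_trans le_add_self h1
    exact_mod_cast h2
  obtain ⟨w, N, hw, hN⟩ := aux_subst hm (ι '' S) hS' (by
    intro P hP
    have h1 := hco P hP
    have h0 : ((n + 1 : ℕ) : ℕ∞) = ((n + 1 - h : ℕ) : ℕ∞) + h := by
      rw [← Nat.cast_add, Nat.sub_add_cancel hm]
    rw [h0] at h1
    have h2 := (ENat.add_le_add_iff_right (by simp)).mp h1
    exact h2)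
  refine ⟨N, fun e s hes hle => ?_⟩
  let φ : MvPolynomial (Fin (n + 1)) k →+* MvPolynomial (Fin h) L :=
    ((aeval w : MvPolynomial (Fin (n + 1)) L →ₐ[L] MvPolynomial (Fin h) L) : _ →+* _).comp ι
  have hφS : Ideal.map φ (Ideal.span S) =
      Ideal.span ((aeval w : MvPolynomial (Fin (n + 1)) L →ₐ[L] _) '' (ι '' S)) := by
    rw [Ideal.map_span, Set.image_image]
    rfl
  have hφm : ∀ x ∈ maxIdl n k, φ x ∈ idealOfVars (Fin h) L := by
    have : maxIdl n k ≤ Ideal.comap φ (idealOfVars (Fin h) L) := by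
      refine Ideal.span_le.mpr ?_
      rintro _ ⟨i, rfl⟩
      change φ (X i) ∈ idealOfVars (Fin h) L
      have : φ (X i) = w i := by simp [φ, ι]
      rw [this, aux_mem_vars]
      exact (hw i).coeff_eq_zero (by simp)
    exact this
  have hS'' : ∀ f ∈ (aeval w : MvPolynomial (Fin (n + 1)) L →ₐ[L] _) '' (ι '' S),
      f.IsHomogeneous d := by
    rintro _ ⟨f, hf, rfl⟩
    simpa using (hS' f hf).aeval w hw
  have hpow := aux_pow_le _ hS'' hN s
  refine aux_not_le (h := h) (L := L) (p ^ e) (pow_pos hp.pos e) _ hes (hpow.trans ?_)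
  rw [← hφS, ← Ideal.map_pow]
  refine (Ideal.map_mono hle).trans ?_
  rw [frobPow, Ideal.map_span]
  refine Ideal.span_le.mpr ?_
  rintro _ ⟨_, ⟨x, hx, rfl⟩, rfl⟩
  change φ (x ^ (p ^ e)) ∈ _
  rw [map_pow]
  exact aux_frob e _ (hφm x hx)

theorem aux_bdd {n d : ℕ} {k : Type*} [Field k] (q : ℕ)
    (S : Set (MvPolynomial (Fin (n + 1)) k))
    (hhom : ∀ f ∈ S, f.IsHomogeneous d) (hd : 0 < d) :
    BddAbove {r : ℕ | ¬ Ideal.span S ^ r ≤ frobPow q (maxIdl n k)} := by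
  have h1 : Ideal.span S ≤ idealOfVars (Fin (n + 1)) k := by
    refine Ideal.span_le.mpr fun f hf => ?_
    change f ∈ idealOfVars (Fin (n + 1)) k
    rw [aux_mem_vars]
    exact (hhom f hf).coeff_eq_zero (by simpa using hd.ne)
  have h2 : idealOfVars (Fin (n + 1)) k ≤ (frobPow q (maxIdl n k)).radical := by
    intro x hx
    exact ⟨q, Ideal.subset_span ⟨x, hx, rfl⟩⟩
  obtain ⟨N, hN⟩ := Ideal.exists_pow_le_of_le_radical_of_fg h2 (idealOfVars_fg _ _)
  refine ⟨N, fun r hr => ?_⟩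
  by_contra hlt
  exact hr ((Ideal.pow_right_mono h1 r).trans ((Ideal.pow_le_pow_right (by omega)).trans hN))

end Helpers

theorem stmt0 {n d h : ℕ} {p : ℕ} (hp : p.Prime) {k : Type*} [Field k] [CharP k p]
    (I : Ideal (MvPolynomial (Fin (n + 1)) k)) (S : Set (MvPolynomial (Fin (n + 1)) k))
    (hgen : I = Ideal.span S) (hhom : ∀ f ∈ S, f.IsHomogeneous d) (hd : 0 < d)
    (hh : idealHeight I = (h : ℕ∞)) (c : ℝ)
    (hfpt : Tendsto (fun e : ℕ => (nuFn I (p ^ e) : ℝ) / (p : ℝ) ^ e) atTop (nhds c)) :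
    c ≥ (h : ℝ) / d := by
  subst hgen
  obtain ⟨N, hN⟩ := aux_main hp S hhom hd hh
  have hd' : (0 : ℝ) < d := by exact_mod_cast hd
  have key : ∀ e : ℕ, (h : ℝ) / d - ((h + N + d : ℝ) / d) * ((p : ℝ)⁻¹) ^ e ≤
      (nuFn (Ideal.span S) (p ^ e) : ℝ) / (p : ℝ) ^ e := by
    intro e
    have hq : (0 : ℝ) < (p : ℝ) ^ e := pow_pos (by exact_mod_cast hp.pos) e
    have hq1 : 1 ≤ p ^ e := Nat.one_le_pow _ _ hp.pos
    rw [inv_pow, le_div_iff₀ hq, sub_mul, mul_assoc, inv_mul_cancel₀ hq.ne', mul_one,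
      div_mul_eq_mul_div, ← sub_div, div_le_iff₀ hd']
    by_cases hc : N ≤ h * (p ^ e - 1)
    · have h1 : (h * (p ^ e - 1) - N) / d ≤ nuFn (Ideal.span S) (p ^ e) := by
        refine le_csSup (aux_bdd _ S hhom hd) (hN e _ ?_)
        have := Nat.div_mul_le_self (h * (p ^ e - 1) - N) d
        omega
      have h2 : h * (p ^ e - 1) < ((h * (p ^ e - 1) - N) / d) * d + d + N := by
        have := Nat.lt_div_mul_add hd (a := h * (p ^ e - 1) - N)
        omega
      have h3 : h * (p ^ e - 1) ≤ nuFn (Ideal.span S) (p ^ e) * d + d + N := by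
        have := Nat.mul_le_mul_right d h1
        omega
      have h4 : ((h * (p ^ e - 1) : ℕ) : ℝ) ≤
        ((nuFn (Ideal.span S) (p ^ e) * d + d + N : ℕ) : ℝ) := by exact_mod_cast h3
      push_cast [Nat.cast_sub hq1] at h4
      linarith
    · have h3 : h * (p ^ e - 1) ≤ N := by omega
      have h4 : ((h * (p ^ e - 1) : ℕ) : ℝ) ≤ (N : ℝ) := by exact_mod_cast h3
      push_cast [Nat.cast_sub hq1] at h4
      have h5 : (0 : ℝ) ≤ (nuFn (Ideal.span S) (p ^ e) : ℝ) * d := by positivity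
      linarith
  have hlim : Tendsto (fun e : ℕ => (h : ℝ) / d - ((h + N + d : ℝ) / d) * ((p : ℝ)⁻¹) ^ e)
      atTop (nhds ((h : ℝ) / d - ((h + N + d : ℝ) / d) * 0)) := by
    refine tendsto_const_nhds.sub (tendsto_const_nhds.mul ?_)
    refine tendsto_pow_atTop_nhds_zero_of_lt_one (by positivity) ?_
    exact inv_lt_one_of_one_lt₀ (by exact_mod_cast hp.one_lt)
  rw [mul_zero, sub_zero] at hlim
  exact le_of_tendsto_of_tendsto' hlim hfpt key
end
end

section
/- Let k be an algebraically closed field, R = k[x_0,...,x_n], and J ⊆ R a nonzero ideal generated by d-forms with essential codimension n+1. Then for a general hyperplane H through the origin, the restriction J|_H has essential codimension n. -/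
open MvPolynomial

noncomputable section

variable {k : Type*} [Field k]

/-- Essential codimension of an ideal of `k[x_0,…,x_n]`. -/
def essCodim {m : ℕ} (J : Ideal (MvPolynomial (Fin m) k)) : ℕ :=
  sInf {r : ℕ | ∃ ℓ : Fin r → MvPolynomial (Fin m) k,
    (∀ i, (ℓ i).IsHomogeneous 1) ∧
    ∃ S : Set (MvPolynomial (Fin m) k),
      S ⊆ (Algebra.adjoin k (Set.range ℓ) : Subalgebra k (MvPolynomial (Fin m) k)) ∧
      J = Ideal.span S}

/-- The linear form with coefficient vector `c`. -/
def linForm {m : ℕ} (c : Fin m → k) : MvPolynomial (Fin m) k :=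
  ∑ i, MvPolynomial.C (c i) * X i

/-- Essential codimension of an ideal of the quotient `R ⧸ (ℓ)` of `R = k[x_0,…,x_n]`
by a linear form `ℓ`: the minimal `r` such that the ideal is generated by images of
elements of a subring `k[ℓ_1,…,ℓ_r]` generated by `r` linear forms of `R`. -/
def essCodimQuot {m : ℕ} (ℓ : MvPolynomial (Fin m) k)
    (Jb : Ideal (MvPolynomial (Fin m) k ⧸ Ideal.span {ℓ})) : ℕ :=
  sInf {r : ℕ | ∃ L : Fin r → MvPolynomial (Fin m) k,
    (∀ i, (L i).IsHomogeneous 1) ∧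
    ∃ S : Set (MvPolynomial (Fin m) k),
      S ⊆ (Algebra.adjoin k (Set.range L) : Subalgebra k (MvPolynomial (Fin m) k)) ∧
      Jb = (Ideal.span S).map (Ideal.Quotient.mk (Ideal.span {ℓ}))}


lemma aux_deg {σ : Type*} {d : ℕ} {p : MvPolynomial σ k} (hp : p.IsHomogeneous d)
    {m : σ →₀ ℕ} (hm : coeff m p ≠ 0) : m.degree = d := by
  have h := hp hm
  rw [Finsupp.degree_eq_weight_one]
  exact h

lemma aux_scale {σ R : Type*} [CommRing R] [Algebra k R] {d : ℕ} {p : MvPolynomial σ k}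
    (hp : p.IsHomogeneous d) (s : R) (x : σ → R) :
    aeval (fun i => s * x i) p = s ^ d * aeval x p := by
  rw [aeval_def, aeval_def, eval₂_eq, eval₂_eq, Finset.mul_sum]
  refine Finset.sum_congr rfl fun m hm => ?_
  rw [← aux_deg hp (mem_support_iff.mp hm), Finsupp.degree_apply]
  simp only [mul_pow, Finset.prod_mul_distrib, Finset.prod_pow_eq_pow_sum]
  ring

lemma aux_theta {σ : Type*} {d : ℕ} {p : MvPolynomial σ k}
    (hp : p.IsHomogeneous d) (x u : σ → k) :
    (aeval (fun i => Polynomial.C (x i) * Polynomial.X + Polynomial.C (u i)) p).natDegree ≤ d ∧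
    (aeval (fun i => Polynomial.C (x i) * Polynomial.X + Polynomial.C (u i)) p).coeff d
      = eval x p := by
  have hlin : ∀ i, (Polynomial.C (x i) * Polynomial.X + Polynomial.C (u i)).natDegree ≤ 1 :=
    fun i => Polynomial.natDegree_linear_le
  have hm : ∀ m : σ →₀ ℕ, (∏ i ∈ m.support,
      (Polynomial.C (x i) * Polynomial.X + Polynomial.C (u i)) ^ m i).natDegree ≤ m.degree ∧
      (∏ i ∈ m.support,
      (Polynomial.C (x i) * Polynomial.X + Polynomial.C (u i)) ^ m i).coeff m.degree
        = ∏ i ∈ m.support, x i ^ m i := by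
    intro m
    rw [Finsupp.degree_apply]
    induction m.support using Finset.cons_induction with
    | empty => simp
    | cons a s ha ih =>
      simp only [Finset.prod_cons, Finset.sum_cons]
      have h1 : ((Polynomial.C (x a) * Polynomial.X + Polynomial.C (u a)) ^ m a).natDegree
          ≤ m a := by
        simpa using Polynomial.natDegree_pow_le_of_le (m a) (hlin a)
      refine ⟨Polynomial.natDegree_mul_le_of_le h1 ih.1, ?_⟩
      rw [Polynomial.coeff_mul_add_eq_of_natDegree_le h1 ih.1, ih.2]
      have := Polynomial.coeff_pow_of_natDegree_le (m := m a) (hlin a)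
      rw [mul_one] at this
      rw [this]
      simp
  rw [aeval_def, eval₂_eq, eval_eq]
  have hd : ∀ m ∈ p.support, m.degree = d := fun m h =>
    aux_deg hp (mem_support_iff.mp h)
  constructor
  · refine Polynomial.natDegree_sum_le_of_forall_le _ _ fun m h => ?_
    rw [← hd m h]
    exact (Polynomial.natDegree_C_mul_le _ _).trans (hm m).1
  · rw [Polynomial.finsetSum_coeff]
    refine Finset.sum_congr rfl fun m h => ?_
    rw [← hd m h]
    rw [Polynomial.algebraMap_eq, Polynomial.coeff_C_mul, (hm m).2]

lemma aux_lin {m : ℕ} {p : MvPolynomial (Fin m) k} (hp : p.IsHomogeneous 1) :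
    ∃ c : Fin m → k, p = linForm c := by
  refine ⟨fun i => coeff (Finsupp.single i 1) p, ?_⟩
  ext e
  simp only [linForm, coeff_sum, coeff_C_mul, coeff_X]
  by_cases he : ∃ i, e = Finsupp.single i 1
  · obtain ⟨i, rfl⟩ := he
    simp [Finsupp.single_left_inj]
  · push Not at he
    have : coeff e p = 0 := by
      by_contra h
      have := aux_deg hp h
      obtain ⟨i, hi⟩ := (Finsupp.sum_eq_one_iff e).mp this
      exact he i hi
    rw [this, Finset.sum_eq_zero]
    intro i _
    simp [(he i).symm]

lemma aux_linhom {m : ℕ} (c : Fin m → k) : (linForm c).IsHomogeneous 1 :=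
  IsHomogeneous.sum _ _ _ fun _ _ => isHomogeneous_C_mul_X _ _

lemma aux_linaeval {m : ℕ} {R : Type*} [CommRing R] [Algebra k R] (c : Fin m → k) (x : Fin m → R) :
    aeval x (linForm c) = ∑ i, algebraMap k R (c i) * x i := by
  simp [linForm]

lemma aux_vertex [Infinite k] {n d r : ℕ} (J : Ideal (MvPolynomial (Fin (n + 1)) k))
    (f : Fin r → MvPolynomial (Fin (n + 1)) k)
    (hgen : J = Ideal.span (Set.range f)) (hhom : ∀ i, (f i).IsHomogeneous d)
    (hess : essCodim J = n + 1) (v : Fin (n + 1) → k) (hv : v ≠ 0) :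
    ∃ i, ∃ x : Fin (n + 1) → k, aeval (fun j => x j + v j) (f i) ≠ aeval x (f i) := by
  by_contra! h
  have h2 : ∀ i, ∀ x : Fin (n + 1) → k, ∀ s : k,
      aeval (fun j => x j + s * v j) (f i) = aeval x (f i) := by
    intro i x s
    by_cases hs : s = 0
    · simp [hs]
    have e1 : (fun j => x j + s * v j) = fun j => s * (s⁻¹ * x j + v j) := by
      funext j; field_simp
    have e2 : x = fun j => s * (s⁻¹ * x j) := by
      funext j; field_simp
    rw [e1, aux_scale (hhom i), h i (fun j => s⁻¹ * x j), ← aux_scale (hhom i), ← e2]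
  obtain ⟨i0, hi0⟩ := Function.ne_iff.mp hv
  simp only [Pi.zero_apply] at hi0
  have hmem : n ∈ {r : ℕ | ∃ ℓ : Fin r → MvPolynomial (Fin (n + 1)) k,
    (∀ i, (ℓ i).IsHomogeneous 1) ∧
    ∃ S : Set (MvPolynomial (Fin (n + 1)) k),
      S ⊆ (Algebra.adjoin k (Set.range ℓ) : Subalgebra k (MvPolynomial (Fin (n + 1)) k)) ∧
      J = Ideal.span S} := by
    let g : Fin (n + 1) → MvPolynomial (Fin (n + 1)) k :=
      fun j => X j - C (v j / v i0) * X i0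
    refine ⟨fun j => g (i0.succAbove j), fun j => ?_, Set.range f, ?_, hgen⟩
    · exact (isHomogeneous_X _ _).sub (isHomogeneous_C_mul_X _ _)
    · rintro _ ⟨i, rfl⟩
      have hf : f i = aeval g (f i) := by
        apply MvPolynomial.funext
        intro x
        rw [← MvPolynomial.coe_aeval_eq_eval x]
        simp only [RingHom.coe_coe]
        have := comp_aeval_apply (R := k) g (aeval x) (f i)
        rw [this, ← h2 i x (- (x i0 / v i0))]
        congr 2
        funext j
        simp [g]
        ring
      rw [hf]
      have hg : ∀ j, g j ∈ Algebra.adjoin k (Set.range fun j => g (i0.succAbove j)) := by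
        intro j
        by_cases hj : j = i0
        · subst hj
          have : g j = 0 := by simp [g, hi0]
          rw [this]; exact zero_mem _
        · obtain ⟨l, rfl⟩ := Fin.exists_succAbove_eq hj
          exact Algebra.subset_adjoin ⟨l, rfl⟩
      have h3 : aeval g (f i) ∈ (aeval g : MvPolynomial (Fin (n + 1)) k →ₐ[k] _).range := ⟨_, rfl⟩
      rw [← Algebra.adjoin_range_eq_range_aeval] at h3
      refine Algebra.adjoin_le ?_ h3
      rintro _ ⟨j, rfl⟩
      exact hg j
  have := Nat.sInf_le hmem
  rw [essCodim] at hess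
  omega

lemma aux_upper {n r : ℕ} (J : Ideal (MvPolynomial (Fin (n + 1)) k))
    (f : Fin r → MvPolynomial (Fin (n + 1)) k)
    (hgen : J = Ideal.span (Set.range f)) (c : Fin (n + 1) → k) (hc : c 0 ≠ 0) :
    n ∈ {r : ℕ | ∃ L : Fin r → MvPolynomial (Fin (n + 1)) k,
    (∀ i, (L i).IsHomogeneous 1) ∧
    ∃ S : Set (MvPolynomial (Fin (n + 1)) k),
      S ⊆ (Algebra.adjoin k (Set.range L) : Subalgebra k (MvPolynomial (Fin (n + 1)) k)) ∧
      J.map (Ideal.Quotient.mk (Ideal.span {linForm c})) =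
        (Ideal.span S).map (Ideal.Quotient.mk (Ideal.span {linForm c}))} := by
  let g : Fin (n + 1) → MvPolynomial (Fin (n + 1)) k :=
    Fin.cons (∑ j : Fin n, C (- (c j.succ / c 0)) * X j.succ) (fun j => X j.succ)
  refine ⟨fun j => X j.succ, fun j => isHomogeneous_X _ _, Set.range fun i => aeval g (f i), ?_, ?_⟩
  · rintro _ ⟨i, rfl⟩
    have h3 : aeval g (f i) ∈ (aeval g : MvPolynomial (Fin (n + 1)) k →ₐ[k] _).range := ⟨_, rfl⟩
    rw [← Algebra.adjoin_range_eq_range_aeval] at h3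
    refine Algebra.adjoin_le ?_ h3
    rintro _ ⟨j, rfl⟩
    have hX : ∀ l : Fin n, (X l.succ : MvPolynomial (Fin (n + 1)) k) ∈
        Algebra.adjoin k (Set.range fun j : Fin n => (X j.succ : MvPolynomial (Fin (n + 1)) k)) :=
      fun l => Algebra.subset_adjoin ⟨l, rfl⟩
    refine Fin.cases ?_ (fun l => ?_) j
    · simp only [g, Fin.cons_zero]
      exact sum_mem fun l _ => mul_mem (Subalgebra.algebraMap_mem _ _) (hX l)
    · simp only [g, Fin.cons_succ]
      exact hX l
  · rw [hgen, Ideal.map_span, Ideal.map_span, ← Set.range_comp, ← Set.range_comp]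
    congr 2
    funext i
    simp only [Function.comp]
    let q : MvPolynomial (Fin (n + 1)) k →ₐ[k] (MvPolynomial (Fin (n + 1)) k ⧸ Ideal.span {linForm c}) :=
      Ideal.Quotient.mkₐ k _
    change q (f i) = q (aeval g (f i))
    suffices h : q = q.comp (aeval g) by
      conv_lhs => rw [h]
      rfl
    apply MvPolynomial.algHom_ext
    intro j
    simp only [AlgHom.comp_apply, aeval_X]
    refine Fin.cases ?_ (fun l => ?_) j
    · apply Ideal.Quotient.eq.mpr
      rw [Ideal.mem_span_singleton]
      refine ⟨C (c 0)⁻¹, ?_⟩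
      simp only [g, Fin.cons_zero, linForm, Fin.sum_univ_succ]
      rw [add_mul, mul_right_comm, ← C_mul, mul_inv_cancel₀ hc, C_1, one_mul, sub_eq_add_neg,
        ← Finset.sum_neg_distrib, Finset.sum_mul]
      congr 1
      refine Finset.sum_congr rfl fun l _ => ?_
      rw [div_eq_mul_inv, C_neg, C_mul]
      ring
    · simp [g]

lemma aux_bad {n d r s : ℕ} (J : Ideal (MvPolynomial (Fin (n + 1)) k))
    (f : Fin r → MvPolynomial (Fin (n + 1)) k)
    (hgen : J = Ideal.span (Set.range f)) (hhom : ∀ i, (f i).IsHomogeneous d)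
    (c : Fin (n + 1) → k) (hs : s < n) (L : Fin s → MvPolynomial (Fin (n + 1)) k)
    (hL : ∀ i, (L i).IsHomogeneous 1) (S : Set (MvPolynomial (Fin (n + 1)) k))
    (hS : S ⊆ (Algebra.adjoin k (Set.range L) : Subalgebra k (MvPolynomial (Fin (n + 1)) k)))
    (hJS : J.map (Ideal.Quotient.mk (Ideal.span {linForm c})) =
        (Ideal.span S).map (Ideal.Quotient.mk (Ideal.span {linForm c}))) :
    ∃ v : Fin (n + 1) → k, v ≠ 0 ∧ ∀ (t : k) (x : Fin (n + 1) → k), ∑ j, c j * x j = 0 →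
      ∀ i, aeval (fun j => x j + t * v j) (f i) = aeval x (f i) := by
  choose a ha using fun i => aux_lin (hL i)
  let M : Matrix (Fin (s + 1)) (Fin (n + 1)) k := Fin.cons c a
  have hker : LinearMap.ker M.mulVecLin ≠ ⊥ :=
    LinearMap.ker_ne_bot_of_finrank_lt (by simpa using hs)
  obtain ⟨v, hv, hv0⟩ := (Submodule.ne_bot_iff _).mp hker
  rw [LinearMap.mem_ker, Matrix.mulVecLin_apply] at hv
  have hcv : ∑ j, c j * v j = 0 := congrFun hv 0
  have hav : ∀ i, ∑ j, a i j * v j = 0 := fun i => congrFun hv i.succ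
  refine ⟨v, hv0, fun t x hx i => ?_⟩
  rw [Ideal.map_eq_iff_sup_ker_eq_of_surjective _ Ideal.Quotient.mk_surjective,
    Ideal.mk_ker] at hJS
  let θ : (Fin (n + 1) → k) → MvPolynomial (Fin (n + 1)) k →ₐ[k] Polynomial k := fun u =>
    aeval (fun i => Polynomial.C (x i) * Polynomial.X + Polynomial.C (u i))
  have hθlin : ∀ (u b : Fin (n + 1) → k), ∑ j, b j * u j = 0 →
      θ u (linForm b) = Polynomial.C (∑ j, b j * x j) * Polynomial.X := by
    intro u b hb
    simp only [θ]
    rw [aux_linaeval]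
    simp only [Polynomial.algebraMap_eq, mul_add, Finset.sum_add_distrib, ← Polynomial.C_mul,
      ← mul_assoc]
    rw [← map_sum, hb, ← Finset.sum_mul, ← map_sum]
    simp
  let u : Fin (n + 1) → k := fun j => t * v j
  have hu : ∀ b : Fin (n + 1) → k, ∑ j, b j * v j = 0 → ∑ j, b j * u j = 0 := by
    intro b hb
    have : ∑ j, b j * u j = t * ∑ j, b j * v j := by
      rw [Finset.mul_sum]
      exact Finset.sum_congr rfl fun j _ => by simp only [u]; ring
    rw [this, hb, mul_zero]
  have h0 : ∀ p ∈ J ⊔ Ideal.span {linForm c}, θ 0 p ∈ Ideal.span {(Polynomial.X : Polynomial k) ^ d} := by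
    suffices J ⊔ Ideal.span {linForm c} ≤ (Ideal.span {(Polynomial.X : Polynomial k) ^ d}).comap (θ 0) from
      fun p hp => this hp
    rw [hgen]
    refine sup_le (Ideal.span_le.mpr ?_) (Ideal.span_le.mpr ?_)
    · rintro _ ⟨i, rfl⟩
      simp only [SetLike.mem_coe, Ideal.mem_comap, Ideal.mem_span_singleton]
      have : θ 0 = aeval (fun i => Polynomial.X * Polynomial.C (x i)) := by
        simp only [θ, Pi.zero_apply, map_zero, add_zero, mul_comm Polynomial.X]
      rw [this, aux_scale (hhom i)]
      exact dvd_mul_right _ _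
    · rintro _ rfl
      simp only [SetLike.mem_coe, Ideal.mem_comap]
      rw [hθlin 0 c (by simp), hx]
      simp
  have hSS : ∀ p ∈ S, θ u p = θ 0 p := by
    intro p hp
    have : Algebra.adjoin k (Set.range L) ≤ AlgHom.equalizer (θ u) (θ 0) := by
      refine Algebra.adjoin_le ?_
      rintro _ ⟨i, rfl⟩
      simp only [SetLike.mem_coe, AlgHom.mem_equalizer]
      rw [ha i, hθlin u _ (hu _ (hav i)), hθlin 0 _ (by simp)]
    exact this (hS hp)
  have h1 : Ideal.span S ⊔ Ideal.span {linForm c} ≤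
      (Ideal.span {(Polynomial.X : Polynomial k) ^ d}).comap (θ u) := by
    refine sup_le (Ideal.span_le.mpr ?_) (Ideal.span_le.mpr ?_)
    · intro p hp
      simp only [SetLike.mem_coe, Ideal.mem_comap]
      rw [hSS p hp]
      apply h0
      rw [hJS]
      exact Ideal.mem_sup_left (Ideal.subset_span hp)
    · rintro _ rfl
      simp only [SetLike.mem_coe, Ideal.mem_comap]
      rw [hθlin u c (hu _ hcv), hx]
      simp
  have h2 : θ u (f i) ∈ Ideal.span {(Polynomial.X : Polynomial k) ^ d} := by
    apply h1
    rw [← hJS, hgen]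
    exact Ideal.mem_sup_left (Ideal.subset_span ⟨i, rfl⟩)
  rw [Ideal.mem_span_singleton, Polynomial.X_pow_dvd_iff] at h2
  obtain ⟨hd, hco⟩ := aux_theta (hhom i) x u
  change (θ u (f i)).natDegree ≤ d at hd
  change (θ u (f i)).coeff d = _ at hco
  have h3 : θ u (f i) = Polynomial.C (eval x (f i)) * Polynomial.X ^ d := by
    ext e
    rw [Polynomial.coeff_C_mul_X_pow]
    rcases lt_trichotomy e d with h | h | h
    · rw [h2 e h, if_neg h.ne]
    · rw [h, hco, if_pos rfl]
    · rw [if_neg h.ne', Polynomial.coeff_eq_zero_of_natDegree_lt (hd.trans_lt h)]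
  have h4 := congrArg (Polynomial.aeval (1 : k)) h3
  simp only [θ] at h4
  rw [comp_aeval_apply] at h4
  simpa [u] using h4

/-- Transcendence degree count. -/
lemma aux_trdeg {K : Type*} [Field K] [Algebra k K] {m : ℕ} (l v : Fin m → K)
    (hl : AlgebraicIndependent k l)
    (h : ∀ j, IsAlgebraic (Algebra.adjoin k (Set.range v)) (l j)) :
    AlgebraicIndependent k v := by
  let M := AlgebraicIndependent.matroid k K
  have hI : M.Indep (Set.range l) :=
    AlgebraicIndependent.matroid_indep_iff.mpr hl.to_subtype_range
  have hsub : Set.range l ⊆ M.closure (Set.range v) := by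
    rintro _ ⟨j, rfl⟩
    rw [AlgebraicIndependent.matroid_closure_eq]
    exact h j
  have h1 := hI.encard_le_eRk_of_subset hsub
  rw [Matroid.eRk_closure_eq] at h1
  have hcl : (Set.range l).encard = m := by
    rw [← Set.image_univ, hl.injective.encard_image]; simp
  obtain ⟨I, hIs, hIi, hIc⟩ := Matroid.le_eRk_iff.mp h1
  rw [hcl] at hIc
  have hcv : (Set.range v).encard ≤ m := by
    rw [← Set.image_univ]
    refine (Set.encard_image_le _ _).trans ?_
    simp
  have hfin : (Set.range v).Finite := Set.finite_range v
  have hIeq : I = Set.range v := (hfin.subset hIs).eq_of_subset_of_encard_le hIs (hcv.trans hIc.ge)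
  have hinj : Function.Injective v := by
    rw [hIeq] at hIc
    rw [← Set.injOn_univ]
    refine Set.finite_univ.injOn_of_encard_image_eq ?_
    rw [Set.image_univ, hIc]; simp
  rw [hIeq] at hIi
  exact AlgebraicIndependent.of_subtype_range hinj
    (AlgebraicIndependent.matroid_indep_iff.mp hIi)

/-- Field-theoretic core. -/
lemma aux_core [Infinite k] {K : Type*} [Field K] [Algebra k K] {n d r : ℕ}
    (f : Fin r → MvPolynomial (Fin (n + 1)) k) (hhom : ∀ i, (f i).IsHomogeneous d)
    (hd : d ≠ 0) (hf : ∃ i, f i ≠ 0)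
    (l v : Fin (n + 1) → K) (hl : AlgebraicIndependent k l) (hv : v ≠ 0)
    (hb : ∀ (t : K) (x : Fin (n + 1) → K), ∑ j, l j * x j = 0 →
      ∀ i, aeval (fun j => x j + t * v j) (f i) = aeval x (f i))
    (hc : ∃ i, ∃ x : Fin (n + 1) → K, aeval (fun j => x j + v j) (f i) ≠ aeval x (f i)) :
    False := by
  obtain ⟨i0, hi0⟩ := Function.ne_iff.mp hv
  simp only [Pi.zero_apply] at hi0
  have hl0 : l 0 ≠ 0 := hl.ne_zero 0
  -- rescale
  let s : K := l 0 / v i0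
  have hs : s ≠ 0 := div_ne_zero hl0 hi0
  let w : Fin (n + 1) → K := fun j => s * v j
  have hw0 : w i0 = l 0 := by simp only [w, s]; field_simp
  have hbw : ∀ (x : Fin (n + 1) → K), ∑ j, l j * x j = 0 →
      ∀ i, aeval (fun j => x j + w j) (f i) = aeval x (f i) := fun x hx i => hb s x hx i
  obtain ⟨i, x, hx⟩ := hc
  have hcw : ∃ x : Fin (n + 1) → K, aeval (fun j => x j + w j) (f i) ≠ aeval x (f i) := by
    refine ⟨fun j => s * x j, ?_⟩
    have e1 : (fun j => s * x j + w j) = fun j => s * (x j + v j) := by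
      funext j; simp only [w]; ring
    rw [e1, aux_scale (hhom i), aux_scale (hhom i)]
    exact fun h => hx (mul_left_cancel₀ (pow_ne_zero _ hs) h)
  -- `w` is algebraically dependent
  obtain ⟨i1, hi1⟩ := hf
  have hdep : ¬ AlgebraicIndependent k w := by
    intro hw
    apply hi1
    apply (injective_iff_map_eq_zero _).mp (algebraicIndependent_iff_injective_aeval.mp hw)
    have h0 := hbw 0 (by simp) i1
    have h1 := aux_scale (hhom i1) (0 : K) (0 : Fin (n + 1) → K)
    simp only [Pi.zero_apply, mul_zero, zero_pow hd, zero_mul, zero_add] at h1 h0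
    rw [h0]
    exact h1
  apply hdep
  refine aux_trdeg l w hl ?_
  let E := Algebra.adjoin k (Set.range w)
  have hwE : ∀ j, w j ∈ E := fun j => Algebra.subset_adjoin ⟨j, rfl⟩
  let wE : Fin (n + 1) → E := fun j => ⟨w j, hwE j⟩
  have : Infinite E := Infinite.of_injective (algebraMap k E) (algebraMap k E).injective
  let F : MvPolynomial (Fin (n + 1)) E := map (algebraMap k E) (f i)
  let Q : MvPolynomial (Fin (n + 1)) E := aeval (fun j => X j + C (wE j)) (f i) - F
  have hQ : ∀ {R : Type _} [CommRing R] [Algebra k R] [Algebra E R] [IsScalarTower k E R]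
      (y : Fin (n + 1) → R), aeval y Q =
        aeval (fun j => y j + algebraMap E R (wE j)) (f i) - aeval y (f i) := by
    intro R _ _ _ _ y
    simp only [Q, F, map_sub, aeval_map_algebraMap]
    congr 1
    rw [← AlgHom.restrictScalars_apply k (aeval y), comp_aeval_apply]
    simp
  have hQ0 : Q ≠ 0 := by
    obtain ⟨y, hy⟩ := hcw
    intro h
    have := hQ (R := K) y
    rw [h, map_zero] at this
    exact hy (sub_eq_zero.mp this.symm)
  -- algebraicity at points where `Q` does not vanish
  have halg : ∀ y : Fin (n + 1) → E, eval y Q ≠ 0 →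
      IsAlgebraic E ((∑ j, l j * (y j : K)) / l 0) := by
    intro y hy
    let p : Polynomial E := aeval (fun j => Polynomial.C (y j) -
      Polynomial.C (if j = 0 then (1 : E) else 0) * Polynomial.X) Q
    refine ⟨p, ?_, ?_⟩
    · intro hp
      apply hy
      have := congrArg (Polynomial.aeval (0 : E)) hp
      simp only [p] at this
      rw [comp_aeval_apply] at this
      simp only [map_sub, map_mul, Polynomial.aeval_C, Polynomial.aeval_X, mul_zero, sub_zero,
        map_zero] at this
      exact this
    · simp only [p]
      rw [comp_aeval_apply, hQ, sub_eq_zero]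
      apply hbw
      simp only [map_sub, map_mul, Polynomial.aeval_C, Polynomial.aeval_X, mul_sub,
        Finset.sum_sub_distrib]
      have hsum : ∀ z : K, ∑ j, l j * (algebraMap E K (if j = 0 then (1 : E) else 0) * z)
          = l 0 * z := by
        intro z
        rw [Finset.sum_eq_single (0 : Fin (n + 1)) (by
          intro b _ hb0; simp [hb0]) (by simp)]
        simp
      rw [hsum, mul_div_cancel₀ _ hl0, sub_eq_zero]
      rfl
  intro j
  have hj : IsAlgebraic E (l j / l 0) := by
    let Q' : MvPolynomial (Fin (n + 1)) E :=
      aeval (fun a => X a + C (if a = j then (1 : E) else 0)) Q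
    have hQ' : ∀ y, eval y Q' = eval (fun a => y a + if a = j then (1 : E) else 0) Q := by
      intro y
      simp only [Q']
      rw [← MvPolynomial.coe_aeval_eq_eval, ← MvPolynomial.coe_aeval_eq_eval]
      simp only [RingHom.coe_coe]
      rw [comp_aeval_apply]
      simp
    have hQ'0 : Q' ≠ 0 := by
      intro h
      apply hQ0
      apply MvPolynomial.funext
      intro y
      have := hQ' (fun a => y a - if a = j then (1 : E) else 0)
      rw [h] at this
      simpa using this.symm
    have hprod : Q * Q' ≠ 0 := mul_ne_zero hQ0 hQ'0
    obtain ⟨y, hy⟩ : ∃ y, eval y (Q * Q') ≠ 0 := by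
      by_contra! h
      exact hprod (MvPolynomial.funext fun y => by rw [h y, map_zero])
    rw [map_mul] at hy
    have a1 := halg y (left_ne_zero_of_mul hy)
    have a2 := halg (fun a => y a + if a = j then (1 : E) else 0)
      (by rw [← hQ']; exact right_ne_zero_of_mul hy)
    have := a2.sub a1
    have he : l j / l 0 = (∑ a, l a * ((y a + if a = j then (1 : E) else 0 : E) : K)) / l 0
        - (∑ a, l a * (y a : K)) / l 0 := by
      rw [← sub_div, ← Finset.sum_sub_distrib]
      congr 1
      rw [Finset.sum_eq_single j (by intro b _ hbj; simp [hbj]) (by simp)]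
      simp
      ring
    rw [he]
    exact this
  have h0 : IsAlgebraic E (l 0) := by
    rw [← hw0]
    exact isAlgebraic_algebraMap (wE i0)
  have := hj.mul h0
  rwa [div_mul_cancel₀ _ hl0] at this

lemma aux_gen {B : Type*} {m : ℕ} (pt : B → Fin m → k)
    (hdense : ∀ g : MvPolynomial (Fin m) k, g ≠ 0 → ∃ b, eval (pt b) g ≠ 0) :
    ∃ P : Ideal (B → k), P.IsMaximal ∧
      ∀ g : MvPolynomial (Fin m) k, g ≠ 0 → (fun b => eval (pt b) g) ∉ P := by
  let ev : MvPolynomial (Fin m) k →+* (B → k) := Pi.ringHom fun b => eval (pt b)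
  let S : Submonoid (B → k) := (nonZeroDivisors (MvPolynomial (Fin m) k)).map ev
  have hdis : Disjoint ((⊥ : Ideal (B → k)) : Set (B → k)) S := by
    rw [Set.disjoint_left]
    rintro a ha ⟨g, hg, rfl⟩
    obtain ⟨b, hb⟩ := hdense g (nonZeroDivisors.ne_zero hg)
    exact hb (congrFun (show ev g = 0 from ha) b)
  obtain ⟨P, hP, -, hPS⟩ := Ideal.exists_le_prime_disjoint ⊥ S hdis
  refine ⟨P, ?_, fun g hg hgP => ?_⟩
  · rw [Ideal.isMaximal_iff]
    refine ⟨fun h => hP.ne_top ((Ideal.eq_top_iff_one _).mpr h), fun I a hPI haP haI => ?_⟩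
    have h0 : a * (a⁻¹ * a - 1) = 0 := by
      funext b
      by_cases hb : a b = 0 <;> simp [hb]
    have h1 : a⁻¹ * a - 1 ∈ P :=
      (hP.mem_or_mem (show a * (a⁻¹ * a - 1) ∈ P by rw [h0]; exact zero_mem _)).resolve_left haP
    have h2 : (1 : B → k) = a⁻¹ * a - (a⁻¹ * a - 1) := by ring
    rw [h2]
    exact sub_mem (I.mul_mem_left _ haI) (hPI h1)
  · exact Set.disjoint_left.mp hPS hgP ⟨g, mem_nonZeroDivisors_of_ne_zero hg, rfl⟩

lemma aux_pigeon {B : Type*} {ι : Type*} [Fintype ι] (P : Ideal (B → k)) (hP : P ≠ ⊤)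
    (u : ι → B → k) (h : ∀ b, ∃ i, u i b ≠ 0) : ∃ i, u i ∉ P := by
  classical
  by_contra! hu
  apply hP
  rw [Ideal.eq_top_iff_one]
  choose c hc using h
  have : (1 : B → k) = ∑ i, (fun b => if i = c b then (u i b)⁻¹ else 0) * u i := by
    funext b
    rw [Finset.sum_apply, Finset.sum_eq_single (c b)]
    · simp [hc b]
    · intro i _ hi
      simp [hi]
    · simp
  rw [this]
  exact sum_mem fun i _ => P.mul_mem_left _ (hu i)

lemma aux_dense [Infinite k] {n d r : ℕ}
    (f : Fin r → MvPolynomial (Fin (n + 1)) k) (hhom : ∀ i, (f i).IsHomogeneous d)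
    (hd : d ≠ 0) (hf : ∃ i, f i ≠ 0)
    (hvert : ∀ v : Fin (n + 1) → k, v ≠ 0 →
      ∃ i, ∃ x : Fin (n + 1) → k, aeval (fun j => x j + v j) (f i) ≠ aeval x (f i)) :
    ∃ g : MvPolynomial (Fin (n + 1)) k, g ≠ 0 ∧ ∀ c : Fin (n + 1) → k, eval c g ≠ 0 →
      ¬ ∃ v : Fin (n + 1) → k, v ≠ 0 ∧ ∀ (t : k) (x : Fin (n + 1) → k), ∑ j, c j * x j = 0 →
        ∀ i, aeval (fun j => x j + t * v j) (f i) = aeval x (f i) := by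
  by_contra! H
  let B := {c : Fin (n + 1) → k // c 0 ≠ 0 ∧
    ∃ v : Fin (n + 1) → k, v ≠ 0 ∧ ∀ (t : k) (x : Fin (n + 1) → k), ∑ j, c j * x j = 0 →
        ∀ i, aeval (fun j => x j + t * v j) (f i) = aeval x (f i)}
  obtain ⟨P, hP, hPg⟩ := aux_gen (fun b : B => b.1) (by
    intro g hg
    obtain ⟨c, hc, hv⟩ := H (g * X 0) (mul_ne_zero hg (X_ne_zero 0))
    rw [map_mul, eval_X] at hc
    exact ⟨⟨c, right_ne_zero_of_mul hc, hv⟩, left_ne_zero_of_mul hc⟩)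
  choose v hv0 hv using fun b : B => b.2.2
  choose i0 x0 hx0 using fun b : B => hvert (v b) (hv0 b)
  letI : Field ((B → k) ⧸ P) := Ideal.Quotient.field P
  let φ : (B → k) →ₐ[k] ((B → k) ⧸ P) := Ideal.Quotient.mkₐ k P
  have hφs : Function.Surjective φ := Ideal.Quotient.mkₐ_surjective k P
  have hφ0 : ∀ a, φ a = 0 ↔ a ∈ P := fun a => Ideal.Quotient.eq_zero_iff_mem
  have hpt : ∀ (p : MvPolynomial (Fin (n + 1)) k) (a : Fin (n + 1) → B → k) (b : B),
      aeval a p b = aeval (fun j => a j b) p := by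
    intro p a b
    exact comp_aeval_apply a (Pi.evalAlgHom k (fun _ : B => k) b) p
  let lA : Fin (n + 1) → B → k := fun j b => b.1 j
  let vA : Fin (n + 1) → B → k := fun j b => v b j
  refine aux_core f hhom hd hf (fun j => φ (lA j)) (fun j => φ (vA j)) ?_ ?_ ?_ ?_
  · rw [algebraicIndependent_iff]
    intro p hp
    by_contra hp0
    apply hPg p hp0
    rw [← hφ0]
    rw [← comp_aeval_apply] at hp
    rw [← hp]
    congr 1
    funext b
    rw [hpt]
    rfl
  · obtain ⟨j, hj⟩ := aux_pigeon P hP.ne_top vA fun b => Function.ne_iff.mp (hv0 b)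
    intro h
    exact hj ((hφ0 _).mp (congrFun h j))
  · intro t x hx i
    obtain ⟨tA, rfl⟩ := hφs t
    choose y hy using fun j => hφs (x j)
    -- adjust coordinate zero
    let xA : Fin (n + 1) → B → k := Fin.cons
      (fun b => -(∑ j : Fin n, b.1 j.succ * y j.succ b) / b.1 0) (fun j => y j.succ)
    have hsum : ∑ j, lA j * xA j = 0 := by
      funext b
      rw [Fin.sum_univ_succ]
      simp only [xA, lA, Fin.cons_zero, Fin.cons_succ, Pi.add_apply, Pi.mul_apply,
        Finset.sum_apply, Pi.zero_apply]
      rw [mul_div_cancel₀ _ b.2.1]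
      ring
    have hl0 : φ (lA 0) ≠ 0 := by
      intro h
      refine hPg (X 0) (X_ne_zero 0) ?_
      simpa [lA] using (hφ0 _).mp h
    have hxs : ∀ j : Fin n, φ (xA j.succ) = x j.succ := fun j => by
      simp only [xA, Fin.cons_succ]; exact hy _
    have hx0' : φ (xA 0) = x 0 := by
      have e := congrArg φ hsum
      rw [map_sum, map_zero] at e
      simp only [map_mul] at e
      rw [Fin.sum_univ_succ] at e hx
      simp only [hxs] at e
      exact mul_left_cancel₀ hl0 (add_right_cancel (e.trans hx.symm))
    have hxe : x = fun j => φ (xA j) := by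
      funext j
      exact Fin.cases hx0'.symm (fun j => (hxs j).symm) j
    rw [hxe]
    have e1 : (fun j => φ (xA j) + φ tA * φ (vA j)) = fun j => φ (xA j + tA * vA j) := by
      funext j; simp
    rw [e1]
    rw [← comp_aeval_apply (fun j => xA j + tA * vA j) φ, ← comp_aeval_apply xA φ]
    congr 1
    funext b
    rw [hpt, hpt]
    refine hv b (tA b) (fun j => xA j b) ?_ i
    have := congrFun hsum b
    simpa using this
  · let xA : Fin (n + 1) → B → k := fun j b => x0 b j
    obtain ⟨i, hi⟩ := aux_pigeon P hP.ne_top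
      (fun i => aeval (fun j => xA j + vA j) (f i) - aeval xA (f i)) fun b => ⟨i0 b, by
        rw [Pi.sub_apply, hpt, hpt]
        exact sub_ne_zero.mpr (hx0 b)⟩
    refine ⟨i, fun j => φ (xA j), fun h => hi ?_⟩
    rw [← hφ0, map_sub, sub_eq_zero]
    rw [comp_aeval_apply, comp_aeval_apply]
    simpa using h

/-- For a general hyperplane `H = V(ℓ)` through the origin, `ess(J|_H) = n`. -/
theorem stmt3 {n d r : ℕ} [IsAlgClosed k]
    (J : Ideal (MvPolynomial (Fin (n + 1)) k)) (hJ : J ≠ ⊥)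
    (f : Fin r → MvPolynomial (Fin (n + 1)) k)
    (hgen : J = Ideal.span (Set.range f)) (hhom : ∀ i, (f i).IsHomogeneous d)
    (hess : essCodim J = n + 1) :
    ∃ g : MvPolynomial (Fin (n + 1)) k, g ≠ 0 ∧
      ∀ c : Fin (n + 1) → k, eval c g ≠ 0 →
        essCodimQuot (linForm c)
          (J.map (Ideal.Quotient.mk (Ideal.span {linForm c}))) = n := by
  have hinf : Infinite k := IsAlgClosed.instInfinite
  have hvert := aux_vertex J f hgen hhom hess
  have hd : d ≠ 0 := by
    rintro rfl
    obtain ⟨i, x, hx⟩ := hvert 1 one_ne_zero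
    apply hx
    have h1 := aux_scale (hhom i) (0 : k) x
    have h2 := aux_scale (hhom i) (0 : k) (fun j => x j + (1 : Fin (n + 1) → k) j)
    simp only [zero_mul, pow_zero, one_mul] at h1 h2
    rw [← h1, ← h2]
  have hf : ∃ i, f i ≠ 0 := by
    by_contra! h
    apply hJ
    rw [hgen, Ideal.span_eq_bot]
    rintro _ ⟨i, rfl⟩
    exact h i
  obtain ⟨g, hg, hgb⟩ := aux_dense f hhom hd hf hvert
  refine ⟨g * X 0, mul_ne_zero hg (X_ne_zero 0), fun c hc => ?_⟩
  rw [map_mul, eval_X] at hc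
  have hup := aux_upper J f hgen c (right_ne_zero_of_mul hc)
  refine le_antisymm (Nat.sInf_le hup) ?_
  by_contra! hlt
  obtain ⟨L, hL, S, hS, hJS⟩ := Nat.sInf_mem ⟨n, hup⟩
  exact hgb c (left_ne_zero_of_mul hc) (aux_bad J f hgen hhom c hlt L hL S hS hJS)
end
end

section
/- Let K ⊆ ℝ^n be a compact convex body of positive volume with centroid c, and let H^+ be a closed half-space whose boundary hyperplane contains c. Then vol(H^+ ∩ K) ≤ (1 - (n/(n+1))^n) · vol(K). -/
open MeasureTheory
open scoped ENNReal Pointwise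

lemma one_dim_aux (A B C : Set ℝ) (hA : MeasurableSet A) (hB : MeasurableSet B)
    (hAn : A.Nonempty) (hBn : B.Nonempty)
    (h : ∀ a ∈ A, ∀ b ∈ B, a + b ∈ C) : volume A + volume B ≤ volume C := by
  obtain ⟨a0, ha0⟩ := hAn
  obtain ⟨b0, hb0⟩ := hBn
  have key : ∀ K ⊆ A, IsCompact K → ∀ L ⊆ B, IsCompact L → volume K + volume L ≤ volume C := by
    intro K hKA hK L hLB hL
    obtain ⟨m, hm⟩ := (hK.insert a0).exists_isGreatest ⟨a0, Set.mem_insert _ _⟩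
    obtain ⟨l, hl⟩ := (hL.insert b0).exists_isLeast ⟨b0, Set.mem_insert _ _⟩
    have hmA : m ∈ A := by
      rcases hm.1 with h | h
      · rw [h]; exact ha0
      · exact hKA h
    have hlB : l ∈ B := by
      rcases hl.1 with h | h
      · rw [h]; exact hb0
      · exact hLB h
    have e1 : volume ((fun x => x + l) '' K) = volume K := by
      simp
    have e2 : volume ((fun x => m + x) '' L) = volume L := by
      simp
    rw [← e1, ← e2, ← measure_union₀]
    · apply measure_mono
      rintro _ (⟨x, hx, rfl⟩ | ⟨x, hx, rfl⟩)
      · exact h _ (hKA hx) _ hlB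
      · exact h _ hmA _ (hLB hx)
    · exact ((hL.image (by fun_prop)).measurableSet).nullMeasurableSet
    · refine measure_mono_null (t := {m + l}) ?_ (by simp)
      rintro _ ⟨⟨x, hx, rfl⟩, ⟨y, hy, hxy⟩⟩
      have h1 := hm.2 (Set.mem_insert_of_mem _ hx)
      have h2 := hl.2 (Set.mem_insert_of_mem _ hy)
      simp only at hxy
      simp only [Set.mem_singleton_iff]
      linarith
  rw [hA.measure_eq_iSup_isCompact, hB.measure_eq_iSup_isCompact]
  simp only [iSup_and']
  rw [ENNReal.iSup_add]
  refine iSup_le fun K => ?_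
  by_cases hK : K ⊆ A ∧ IsCompact K
  · simp only [hK, and_self, iSup_true]
    rw [ENNReal.add_iSup]
    refine iSup_le fun L => ?_
    by_cases hL : L ⊆ B ∧ IsCompact L
    · simp only [hL, and_self, iSup_true]
      exact key K hK.1 hK.2 L hL.1 hL.2
    · simp only [hL, iSup_false, bot_eq_zero, add_zero]
      simpa using key K hK.1 hK.2 ∅ (by simp) (by simp)
  · simp only [hK, iSup_false, bot_eq_zero, zero_add]
    refine iSup_le fun L => ?_
    refine iSup_le fun hL => ?_
    simpa using key ∅ (by simp) (by simp) L hL.1 hL.2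

lemma one_dim_sets (A B C : Set ℝ) (hA : MeasurableSet A) (hB : MeasurableSet B)
    (hAn : A.Nonempty) (hBn : B.Nonempty) {p q : ℝ} (hp : 0 < p) (hq : 0 < q)
    (h : ∀ a ∈ A, ∀ b ∈ B, p * a + q * b ∈ C) :
    ENNReal.ofReal p * volume A + ENNReal.ofReal q * volume B ≤ volume C := by
  have := one_dim_aux (p • A) (q • B) C (hA.const_smul₀ p) (hB.const_smul₀ q) hAn.smul_set
    hBn.smul_set (by
      rintro _ ⟨a, ha, rfl⟩ _ ⟨b, hb, rfl⟩
      exact h a ha b hb)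
  simpa [Measure.addHaar_smul, abs_of_pos hp, abs_of_pos hq] using this

lemma layer (f : ℝ → ℝ≥0∞) (hf : Measurable f) (h1 : ∀ x, f x ≤ 1) :
    ∫⁻ x, f x = ∫⁻ r in Set.Ioi (0:ℝ), volume {x | ENNReal.ofReal r < f x} := by
  have hfin : ∀ x, f x ≠ ∞ := fun x => ((h1 x).trans_lt ENNReal.one_lt_top).ne
  have := lintegral_eq_lintegral_meas_lt (volume : Measure ℝ) (f := fun x => (f x).toReal)
    (Filter.Eventually.of_forall fun x => ENNReal.toReal_nonneg) hf.ennreal_toReal.aemeasurable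
  simp only [ENNReal.ofReal_toReal (hfin _)] at this
  rw [this]
  refine setLIntegral_congr_fun measurableSet_Ioi fun r hr => ?_
  congr 1
  ext x
  simp only [Set.mem_ofPred_eq]
  exact (ENNReal.ofReal_lt_iff_lt_toReal (le_of_lt hr) (hfin x)).symm

lemma pl_norm (f g h : ℝ → ℝ≥0∞) (hf : Measurable f) (hg : Measurable g) (hh : Measurable h)
    {p q : ℝ} (hp : 0 < p) (hq : 0 < q) (hpq : p + q = 1)
    (hfs : ⨆ x, f x = 1) (hgs : ⨆ x, g x = 1)
    (H : ∀ x y, f x ^ p * g y ^ q ≤ h (p * x + q * y)) :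
    ENNReal.ofReal p * (∫⁻ x, f x) + ENNReal.ofReal q * (∫⁻ x, g x) ≤ ∫⁻ x, h x := by
  have hf1 : ∀ x, f x ≤ 1 := fun x => hfs ▸ le_iSup f x
  have hg1 : ∀ x, g x ≤ 1 := fun x => hgs ▸ le_iSup g x
  have hle : ∫⁻ x, min (h x) 1 ≤ ∫⁻ x, h x := lintegral_mono fun x => min_le_left _ _
  refine le_trans ?_ hle
  rw [layer f hf hf1, layer g hg hg1, layer _ (hh.min measurable_const) (fun x => min_le_right _ _)]
  rw [← lintegral_const_mul' _ _ ENNReal.ofReal_ne_top,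
    ← lintegral_const_mul' _ _ ENNReal.ofReal_ne_top]
  refine (le_lintegral_add _ _).trans ?_
  refine lintegral_mono_ae ((ae_restrict_iff' measurableSet_Ioi).2 (Filter.Eventually.of_forall ?_))
  intro r hr
  have hr : 0 < r := hr
  by_cases hr1 : 1 ≤ r
  · have h1r : 1 ≤ ENNReal.ofReal r := by simpa using hr1
    have ef : {x | ENNReal.ofReal r < f x} = ∅ := by
      ext x; simpa using (hf1 x).trans h1r
    have eg : {x | ENNReal.ofReal r < g x} = ∅ := by
      ext x; simpa using (hg1 x).trans h1r
    simp [ef, eg]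
  · push Not at hr1
    have h1r : ENNReal.ofReal r < 1 := by simpa using hr1
    apply one_dim_sets _ _ _ (measurableSet_lt measurable_const hf)
      (measurableSet_lt measurable_const hg) ?_ ?_ hp hq
    · intro a ha b hb
      simp only [Set.mem_ofPred_eq, lt_min_iff] at *
      refine ⟨lt_of_lt_of_le ?_ (H a b), h1r⟩
      calc ENNReal.ofReal r = ENNReal.ofReal r ^ p * ENNReal.ofReal r ^ q := by
            rw [← ENNReal.rpow_add _ _ (by simpa using hr) (by simp), hpq, ENNReal.rpow_one]
        _ < _ := ENNReal.mul_lt_mul (ENNReal.rpow_lt_rpow ha hp) (ENNReal.rpow_lt_rpow hb hq)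
    · rw [← hfs] at h1r
      exact lt_iSup_iff.1 h1r
    · rw [← hgs] at h1r
      exact lt_iSup_iff.1 h1r

lemma amgm (a b : ℝ≥0∞) {p q : ℝ} (hp : 0 < p) (hq : 0 < q) (hpq : p + q = 1) :
    a ^ p * b ^ q ≤ ENNReal.ofReal p * a + ENNReal.ofReal q * b := by
  have hc : (p⁻¹).HolderConjugate (q⁻¹) := by
    rw [Real.holderConjugate_iff]
    refine ⟨(one_lt_inv₀ hp).2 (by linarith), by simpa using hpq⟩
  have := ENNReal.young_inequality (a ^ p) (b ^ q) hc
  rw [ENNReal.rpow_rpow_inv hp.ne', ENNReal.rpow_rpow_inv hq.ne', ENNReal.ofReal_inv_of_pos hp,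
    ENNReal.ofReal_inv_of_pos hq, div_eq_mul_inv, div_eq_mul_inv, inv_inv, inv_inv] at this
  rwa [mul_comm _ a, mul_comm _ b]

lemma pl_bdd (f g h : ℝ → ℝ≥0∞) (hf : Measurable f) (hg : Measurable g) (hh : Measurable h)
    {p q : ℝ} (hp : 0 < p) (hq : 0 < q) (hpq : p + q = 1)
    (hfs : ⨆ x, f x ≠ ∞) (hgs : ⨆ x, g x ≠ ∞)
    (H : ∀ x y, f x ^ p * g y ^ q ≤ h (p * x + q * y)) :
    (∫⁻ x, f x) ^ p * (∫⁻ x, g x) ^ q ≤ ∫⁻ x, h x := by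
  set M := ⨆ x, f x with hM
  set N := ⨆ x, g x with hN
  by_cases hM0 : M = 0
  · have : ∀ x, f x = 0 := fun x => le_antisymm (hM0 ▸ le_iSup f x) bot_le
    simp [this, hp]
  by_cases hN0 : N = 0
  · have : ∀ x, g x = 0 := fun x => le_antisymm (hN0 ▸ le_iSup g x) bot_le
    simp [this, hq]
  have hMp0 : M ^ p ≠ 0 := by simp [hM0, hfs]
  have hMpt : M ^ p ≠ ∞ := by simp [hM0, hfs]
  have hNp0 : N ^ q ≠ 0 := by simp [hN0, hgs]
  have hNpt : N ^ q ≠ ∞ := by simp [hN0, hgs]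
  have e : ∀ a b : ℝ≥0∞, (M⁻¹ * a) ^ p * (N⁻¹ * b) ^ q = (M ^ p * N ^ q)⁻¹ * (a ^ p * b ^ q) := by
    intro a b
    rw [ENNReal.mul_rpow_of_nonneg _ _ hp.le, ENNReal.mul_rpow_of_nonneg _ _ hq.le,
      ENNReal.inv_rpow, ENNReal.inv_rpow, ENNReal.mul_inv (Or.inl hMp0) (Or.inl hMpt)]
    ring
  have key := pl_norm (fun x => M⁻¹ * f x) (fun x => N⁻¹ * g x)
    (fun x => (M ^ p * N ^ q)⁻¹ * h x) (hf.const_mul _) (hg.const_mul _) (hh.const_mul _) hp hq hpq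
    (by rw [← ENNReal.mul_iSup]; exact ENNReal.inv_mul_cancel hM0 hfs)
    (by rw [← ENNReal.mul_iSup]; exact ENNReal.inv_mul_cancel hN0 hgs)
    (by
      intro x y
      rw [e]
      gcongr
      exact H x y)
  have k2 := (amgm _ _ hp hq hpq).trans key
  rw [lintegral_const_mul _ hf, lintegral_const_mul _ hg, lintegral_const_mul _ hh, e] at k2
  rwa [ENNReal.mul_le_mul_iff_right] at k2
  · exact ENNReal.inv_ne_zero.2 (ENNReal.mul_ne_top hMpt hNpt)
  · exact ENNReal.inv_ne_top.2 (mul_ne_zero hMp0 hNp0)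

def PLprop (E : Type) [AddCommGroup E] [Module ℝ E] [MeasureSpace E] : Prop :=
  ∀ (p q : ℝ), 0 < p → 0 < q → p + q = 1 → ∀ f g h : E → ℝ≥0∞, Measurable f → Measurable g →
    Measurable h → (∀ x y, f x ^ p * g y ^ q ≤ h (p • x + q • y)) →
    (∫⁻ x, f x) ^ p * (∫⁻ x, g x) ^ q ≤ ∫⁻ x, h x

lemma trunc_tendsto (f : ℝ → ℝ≥0∞) (hf : Measurable f) :
    Filter.Tendsto (fun k : ℕ => ∫⁻ x, min (f x) k) Filter.atTop (nhds (∫⁻ x, f x)) := by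
  apply lintegral_tendsto_of_tendsto_of_monotone
  · intro k
    exact (hf.min measurable_const).aemeasurable
  · refine Filter.Eventually.of_forall fun x i j hij => ?_
    exact min_le_min_left _ (by exact_mod_cast hij)
  · refine Filter.Eventually.of_forall fun x => ?_
    have := (tendsto_const_nhds (x := f x)).min ENNReal.tendsto_nat_nhds_top
    simpa using this

lemma pl_real : PLprop ℝ := by
  intro p q hp hq hpq f g h hf hg hh H
  by_cases hf0 : ∫⁻ x, f x = 0
  · simp [hf0, hp]
  by_cases hg0 : ∫⁻ x, g x = 0
  · simp [hg0, hq]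
  have hb : ∀ (u : ℝ → ℝ≥0∞) (k : ℕ), ⨆ x, min (u x) k ≠ ∞ := fun u k =>
    ((iSup_le fun x => min_le_right _ _).trans_lt (ENNReal.natCast_lt_top k)).ne
  refine le_of_tendsto (ENNReal.Tendsto.mul
    ((ENNReal.continuous_rpow_const.tendsto _).comp (trunc_tendsto f hf)) (Or.inl ?_)
    ((ENNReal.continuous_rpow_const.tendsto _).comp (trunc_tendsto g hg)) (Or.inl ?_))
    (Filter.Eventually.of_forall fun k => pl_bdd _ _ h (hf.min measurable_const)
      (hg.min measurable_const) hh hp hq hpq (hb f k) (hb g k) ?_)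
  · simp [hf0, hp.le]
  · simp [hg0, hq.le]
  · intro x y
    refine le_trans ?_ (H x y)
    gcongr <;> exact min_le_left _ _

lemma pl_prod {E F : Type} [AddCommGroup E] [Module ℝ E] [MeasureSpace E]
    [AddCommGroup F] [Module ℝ F] [MeasureSpace F] [SFinite (volume : Measure F)]
    [SFinite (volume : Measure E)]
    (hE : PLprop E) (hF : PLprop F) : PLprop (E × F) := by
  intro p q hp hq hpq f g h hf hg hh H
  rw [Measure.volume_eq_prod, lintegral_prod _ hf.aemeasurable, lintegral_prod _ hg.aemeasurable,
    lintegral_prod _ hh.aemeasurable]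
  refine hE p q hp hq hpq _ _ _ hf.lintegral_prod_right' hg.lintegral_prod_right'
    hh.lintegral_prod_right' ?_
  intro x y
  refine hF p q hp hq hpq _ _ _ (hf.comp measurable_prodMk_left) (hg.comp measurable_prodMk_left)
    (hh.comp measurable_prodMk_left) ?_
  intro x' y'
  exact H (x, x') (y, y')

lemma pl_equiv {E F : Type} [AddCommGroup E] [Module ℝ E] [MeasureSpace E]
    [AddCommGroup F] [Module ℝ F] [MeasureSpace F] (e : E ≃ᵐ F)
    (he : MeasurePreserving e volume volume)
    (hlin : ∀ (p q : ℝ) x y, e.symm (p • x + q • y) = p • e.symm x + q • e.symm y)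
    (hE : PLprop F) : PLprop E := by
  intro p q hp hq hpq f g h hf hg hh H
  have := hE p q hp hq hpq (f ∘ e.symm) (g ∘ e.symm) (h ∘ e.symm) (hf.comp e.symm.measurable)
    (hg.comp e.symm.measurable) (hh.comp e.symm.measurable) (by
      intro x y
      simp only [Function.comp, hlin]
      exact H _ _)
  have hs := he.symm
  simp only [Function.comp_def] at this
  rwa [hs.lintegral_comp hf, hs.lintegral_comp hg, hs.lintegral_comp hh] at this

lemma pl_pi : ∀ n : ℕ, PLprop (Fin n → ℝ)
  | 0 => by
    intro p q hp hq hpq f g h hf hg hh H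
    have hv : (volume : Measure (Fin 0 → ℝ)) Set.univ = 1 := by
      rw [volume_pi, Measure.pi_of_empty]; simp
    have : ∀ u : (Fin 0 → ℝ) → ℝ≥0∞, ∫⁻ x, u x = u 0 := by
      intro u
      rw [lintegral_congr (g := fun _ => u 0) (fun x => by rw [Subsingleton.elim x 0])]
      rw [lintegral_const, hv, mul_one]
    rw [this, this, this]
    simpa using H 0 0
  | n + 1 => by
    refine pl_equiv (MeasurableEquiv.piFinSuccAbove (fun _ => ℝ) 0)
      (volume_preserving_piFinSuccAbove (fun _ => ℝ) 0) ?_ (pl_prod pl_real (pl_pi n))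
    intro p q x y
    ext i
    refine Fin.cases ?_ (fun j => ?_) i <;> simp [MeasurableEquiv.piFinSuccAbove]

lemma pl_euclid (n : ℕ) : PLprop (EuclideanSpace ℝ (Fin n)) := by
  refine pl_equiv (MeasurableEquiv.toLp 2 (Fin n → ℝ)).symm
    (EuclideanSpace.volume_preserving_symm_measurableEquiv_toLp (Fin n)) ?_ (pl_pi n)
  intro p q x y
  ext i
  simp

/-- Brunn-Minkowski. -/
lemma bm {n : ℕ} (A B C : Set (EuclideanSpace ℝ (Fin n))) (hA : MeasurableSet A)
    (hB : MeasurableSet B) (hC : MeasurableSet C) {a b p q : ℝ} (ha : 0 < a) (hb : 0 < b)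
    (hp : 0 < p) (hq : 0 < q)
    (hAv : volume A = ENNReal.ofReal (a ^ n)) (hBv : volume B = ENNReal.ofReal (b ^ n))
    (H : ∀ x ∈ A, ∀ y ∈ B, p • x + q • y ∈ C) :
    ENNReal.ofReal ((p * a + q * b) ^ n) ≤ volume C := by
  have hc : 0 < p * a + q * b := by positivity
  set c := p * a + q * b with hcdef
  have hvol : ∀ (S : Set (EuclideanSpace ℝ (Fin n))) (r : ℝ), 0 < r →
      volume (r⁻¹ • S) = ENNReal.ofReal ((r ^ n)⁻¹) * volume S := by
    intro S r hr
    rw [Measure.addHaar_smul]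
    simp [abs_of_pos hr]
  have h1 : ∀ r : ℝ, 0 < r → ENNReal.ofReal ((r ^ n)⁻¹) * ENNReal.ofReal (r ^ n) = 1 := by
    intro r hr
    rw [← ENNReal.ofReal_mul (by positivity), inv_mul_cancel₀ (by positivity), ENNReal.ofReal_one]
  have mA := hA.const_smul₀ a⁻¹
  have mB := hB.const_smul₀ b⁻¹
  have mC := hC.const_smul₀ c⁻¹
  have key := pl_euclid n (p * a / c) (q * b / c) (by positivity) (by positivity)
    (by rw [← add_div, ← hcdef, div_self hc.ne'])
    ((a⁻¹ • A).indicator 1) ((b⁻¹ • B).indicator 1) ((c⁻¹ • C).indicator 1)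
    (measurable_one.indicator mA) (measurable_one.indicator mB) (measurable_one.indicator mC) (by
      intro x y
      by_cases hx : x ∈ a⁻¹ • A
      swap
      · have : 0 < p * a / c := by positivity
        simp [hx, this]
      by_cases hy : y ∈ b⁻¹ • B
      swap
      · have : 0 < q * b / c := by positivity
        simp [hy, this]
      have hz : (p * a / c) • x + (q * b / c) • y ∈ c⁻¹ • C := by
        obtain ⟨x', hx', rfl⟩ := hx
        obtain ⟨y', hy', rfl⟩ := hy
        refine ⟨_, H x' hx' y' hy', ?_⟩
        simp only [smul_add, smul_smul]
        congr 2 <;> field_simp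
      simp [hx, hy, hz])
  rw [lintegral_indicator_one mA, lintegral_indicator_one mB, lintegral_indicator_one mC,
    hvol _ _ ha, hvol _ _ hb, hvol _ _ hc, hAv, hBv, h1 a ha, h1 b hb] at key
  simp only [ENNReal.one_rpow, mul_one] at key
  calc ENNReal.ofReal (c ^ n) = ENNReal.ofReal (c ^ n) * 1 := by rw [mul_one]
    _ ≤ ENNReal.ofReal (c ^ n) * (ENNReal.ofReal ((c ^ n)⁻¹) * volume C) := by gcongr
    _ = volume C := by
      rw [← mul_assoc, mul_comm (ENNReal.ofReal (c ^ n)), h1 c hc, one_mul]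

lemma supergrad (S : Set ℝ) (G : ℝ → ℝ) (hG : ConcaveOn ℝ S G) {x : ℝ} (hx : x ∈ interior S) :
    ∃ s, ∀ y ∈ S, G y ≤ G x + s * (y - x) := by
  have hN := hG.neg
  refine ⟨-derivWithin (-G) (Set.Ioi x) x, fun y hy => ?_⟩
  rcases lt_trichotomy y x with h | h | h
  · have h1 := (hN.slope_le_leftDeriv_of_mem_interior hy hx h).trans
      (hN.leftDeriv_le_rightDeriv_of_mem_interior hx)
    rw [slope_def_field, div_le_iff₀ (by linarith)] at h1
    simp only [Pi.neg_apply] at h1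
    linarith
  · simp [h]
  · have h1 := hN.rightDeriv_le_slope_of_mem_interior hx hy h
    rw [slope_def_field, le_div_iff₀ (by linarith)] at h1
    simp only [Pi.neg_apply] at h1
    linarith

lemma hyperplane_null {n : ℕ} (l : EuclideanSpace ℝ (Fin n) →L[ℝ] ℝ) (hl : l ≠ 0) (x : ℝ) :
    volume {v | l v = x} = 0 := by
  obtain ⟨u, hu⟩ : ∃ u, l u ≠ 0 := by
    by_contra h
    push Not at h
    exact hl (ContinuousLinearMap.ext h)
  have := measure_preimage_add_right (volume : Measure (EuclideanSpace ℝ (Fin n)))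
    ((x / l u) • u) {v | l v = x}
  rw [← this]
  have e : (fun h => h + (x / l u) • u) ⁻¹' {v | l v = x} =
      ((l : EuclideanSpace ℝ (Fin n) →ₗ[ℝ] ℝ).ker : Set (EuclideanSpace ℝ (Fin n))) := by
    ext v
    simp [hu]
  rw [e]
  apply Measure.addHaar_submodule
  intro h
  exact hl (ContinuousLinearMap.ext fun v => by
    have : v ∈ (l : EuclideanSpace ℝ (Fin n) →ₗ[ℝ] ℝ).ker := by rw [h]; trivial
    simpa using this)

lemma pow_integral (n : ℕ) {W s : ℝ} (hW : 0 < W) (hs : 0 < s) :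
    ∫⁻ r in Set.Ioc 0 (W / s), ENNReal.ofReal ((W - s * r) ^ n) =
      ENNReal.ofReal (W ^ (n + 1) / (s * (n + 1))) := by
  have hWs : 0 ≤ W / s := by positivity
  have hc : Continuous fun r : ℝ => (W - s * r) ^ n := by fun_prop
  rw [← ofReal_integral_eq_lintegral_ofReal]
  · rw [← intervalIntegral.integral_of_le hWs]
    rw [intervalIntegral.integral_eq_sub_of_hasDerivAt
      (f := fun r => - ((W - s * r) ^ (n + 1) / (s * (n + 1))))]
    · congr 1
      have : W - s * (W / s) = 0 := by field_simp; ring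
      rw [this]
      simp
    · intro r _
      have h1 : HasDerivAt (fun r : ℝ => W - s * r) (-s) r := by
        simpa using ((hasDerivAt_id r).const_mul s).const_sub W
      have h2 := ((h1.pow (n + 1)).div_const (s * (n + 1))).neg
      convert h2 using 1
      · rfl
      · push_cast
        field_simp
    · exact hc.intervalIntegrable _ _
  · exact (hc.integrableOn_Icc).mono_set Set.Ioc_subset_Icc_self
  · refine (ae_restrict_iff' measurableSet_Ioc).2 (Filter.Eventually.of_forall fun r hr => ?_)
    have : s * r ≤ W := by
      have := hr.2
      rw [le_div_iff₀ hs] at this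
      linarith
    exact pow_nonneg (by linarith) n

lemma grunbaum {n : ℕ} (hn : n ≠ 0) (K : Set (EuclideanSpace ℝ (Fin n)))
    (hconv : Convex ℝ K) (hcomp : IsCompact K) (hvol : 0 < volume K)
    (l : EuclideanSpace ℝ (Fin n) →L[ℝ] ℝ) (hl : l ≠ 0) (x : ℝ)
    (hx : ∫ v in K, l v = x * volume.real K) :
    ((n : ℝ) / (n + 1)) ^ n * volume.real K ≤ volume.real (K ∩ {v | l v < x}) := by
  have hfin : volume K ≠ ∞ := hcomp.measure_lt_top.ne
  have hlm : Measurable l := l.continuous.measurable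
  have hKm := hcomp.measurableSet
  have hmS : ∀ t, MeasurableSet (K ∩ {v | l v < t}) := fun t =>
    hKm.inter (measurableSet_lt hlm measurable_const)
  have hIntL : IntegrableOn l K := l.continuous.continuousOn.integrableOn_compact hcomp
  set V := volume.real K with hV
  have hV0 : 0 < V := ENNReal.toReal_pos hvol.ne' hfin
  set F : ℝ → ℝ := fun t => volume.real (K ∩ {v | l v < t}) with hF
  have hFfin : ∀ t, volume (K ∩ {v | l v < t}) ≠ ∞ := fun t =>
    measure_ne_top_of_subset Set.inter_subset_left hfin
  have hF0 : ∀ t, 0 ≤ F t := fun t => measureReal_nonneg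
  have hFmono : Monotone F := by
    intro s t hst
    refine measureReal_mono ?_ (hFfin t)
    exact Set.inter_subset_inter_right _ fun v (hv : l v < s) => hv.trans_le hst
  set G : ℝ → ℝ := fun t => F t ^ ((n : ℝ)⁻¹) with hG
  have hGn : ∀ t, G t ^ n = F t := fun t => Real.rpow_inv_natCast_pow (hF0 t) hn
  have hG0 : ∀ t, 0 ≤ G t := fun t => Real.rpow_nonneg (hF0 t) _
  set S : Set ℝ := {t | 0 < F t} with hS
  have hSup : IsUpperSet S := fun s t hst (hs : 0 < F s) => hs.trans_le (hFmono hst)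
  have hconc : ConcaveOn ℝ S G := by
    rw [concaveOn_iff_forall_pos]
    refine ⟨hSup.ordConnected.convex, ?_⟩
    intro s hs t ht p q hp hq hpq
    have hs : 0 < F s := hs
    have ht : 0 < F t := ht
    have h := bm (K ∩ {v | l v < s}) (K ∩ {v | l v < t}) (K ∩ {v | l v < p * s + q * t})
      (hmS _) (hmS _) (hmS _) (a := G s) (b := G t) (Real.rpow_pos_of_pos hs _)
      (Real.rpow_pos_of_pos ht _) hp hq
      (by rw [hGn, hF, ofReal_measureReal (hFfin s)])
      (by rw [hGn, hF, ofReal_measureReal (hFfin t)]) (by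
        rintro v ⟨hv, hv'⟩ u ⟨hu, hu'⟩
        refine ⟨hconv hv hu hp.le hq.le hpq, ?_⟩
        simp only [Set.mem_ofPred_eq, map_add, map_smul, smul_eq_mul] at *
        have := mul_lt_mul_of_pos_left hv' hp
        have := mul_lt_mul_of_pos_left hu' hq
        linarith)
    rw [ENNReal.ofReal_le_iff_le_toReal (hFfin _)] at h
    change _ ≤ F (p * s + q * t) at h
    rw [← hGn] at h
    exact le_of_pow_le_pow_left₀ hn (hG0 _) h
  have hsub : ∀ t, ∫ v in K, (t - l v) = (t - x) * V := by
    intro t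
    have hct : Integrable (fun _ : EuclideanSpace ℝ (Fin n) => t) (volume.restrict K) :=
      integrableOn_const hfin
    rw [integral_sub hct hIntL, hx]
    simp only [setIntegral_const, smul_eq_mul]
    ring
  -- positivity at the centroid
  have hxpos : volume (K ∩ {v | l v < x}) ≠ 0 := by
    intro h0
    have hae : ∀ᵐ v ∂(volume.restrict K), 0 ≤ l v - x := by
      rw [ae_restrict_iff' hKm]
      rw [measure_eq_zero_iff_ae_notMem] at h0
      filter_upwards [h0] with v hv hvK
      by_contra hc
      exact hv ⟨hvK, by simpa using hc⟩
    have hI : ∫ v in K, (l v - x) = 0 := by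
      have := hsub x
      rw [sub_self, zero_mul] at this
      rw [← neg_eq_zero, ← integral_neg, ← this]
      simp
    have hz := (integral_eq_zero_iff_of_nonneg_ae hae
      (hIntL.sub (integrableOn_const hfin))).1 hI
    rw [Filter.EventuallyEq, ae_restrict_iff' hKm] at hz
    have hnull := hyperplane_null l hl x
    rw [measure_eq_zero_iff_ae_notMem] at hnull
    refine hvol.ne' ?_
    rw [measure_eq_zero_iff_ae_notMem]
    filter_upwards [hz, hnull] with v h1 h2 h3
    exact h2 (by have := h1 h3; simp at this; simpa using (by linarith : l v = x))
  have hxint : x ∈ interior S := by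
    obtain ⟨k, hk⟩ : ∃ k : ℕ, volume (K ∩ {v | l v < x - 1 / (k + 1)}) ≠ 0 := by
      by_contra h
      push Not at h
      refine hxpos (measure_mono_null ?_ (measure_iUnion_null h))
      rintro v ⟨hv, hv'⟩
      have hv' : l v < x := hv'
      obtain ⟨k, hk⟩ := exists_nat_one_div_lt (sub_pos.2 hv')
      refine Set.mem_iUnion.2 ⟨k, hv, ?_⟩
      simp only [Set.mem_ofPred_eq]
      linarith
    have hkS : x - 1 / (k + 1) ∈ S := ENNReal.toReal_pos hk (hFfin _)
    rw [mem_interior]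
    refine ⟨Set.Ioi (x - 1 / (k + 1)), fun t ht => hSup (le_of_lt ht) hkS, isOpen_Ioi, ?_⟩
    have : (0:ℝ) < 1 / (k + 1) := by positivity
    simp only [Set.mem_Ioi]
    linarith
  obtain ⟨s, hs⟩ := supergrad S G hconc hxint
  set W := V ^ ((n : ℝ)⁻¹) with hW
  have hWn : W ^ n = V := Real.rpow_inv_natCast_pow hV0.le hn
  have hW0 : 0 < W := Real.rpow_pos_of_pos hV0 _
  have hfinal : (n : ℝ) / (n + 1) * W ≤ G x → ((n : ℝ) / (n + 1)) ^ n * V ≤ F x := by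
    intro h
    rw [← hWn, ← hGn, ← mul_pow]
    exact pow_le_pow_left₀ (by positivity) h n
  apply hfinal
  have hn1 : (n : ℝ) / (n + 1) ≤ 1 := by
    rw [div_le_one (by positivity)]; linarith
  rcases le_or_gt W (G x) with hWG | hWG
  · exact (mul_le_of_le_one_left hW0.le hn1).trans hWG
  -- slope is positive
  obtain ⟨b, hb⟩ := (hcomp.image l.continuous).bddAbove
  have hFb : ∀ t, b < t → F t = V := by
    intro t ht
    have : K ∩ {v | l v < t} = K := by
      refine Set.inter_eq_left.2 fun v hv => ?_
      exact (hb ⟨v, hv, rfl⟩).trans_lt ht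
    simp only [hF, this, hV]
  have hspos : 0 < s := by
    have h1 : b < max b x + 1 := by linarith [le_max_left b x]
    have h2 : x < max b x + 1 := by linarith [le_max_right b x]
    have h3 := hs (max b x + 1) (by simp only [hS, Set.mem_ofPred_eq, hFb _ h1]; exact hV0)
    have h4 : G (max b x + 1) = W := by simp only [hG, hFb _ h1, hW]
    rw [h4] at h3
    by_contra hc
    push Not at hc
    nlinarith
  set t1 := x + (W - G x) / s with ht1
  have hub : ∫⁻ v in K, ENNReal.ofReal (max (t1 - l v) 0) ≤
      ENNReal.ofReal (W ^ (n + 1) / (s * (n + 1))) := by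
    rw [lintegral_eq_lintegral_meas_lt (f := fun v => max (t1 - l v) 0) _ (Filter.Eventually.of_forall fun v => le_max_right _ _)
      (by fun_prop), ← pow_integral n hW0 hspos]
    rw [← lintegral_indicator measurableSet_Ioi, ← lintegral_indicator measurableSet_Ioc]
    refine lintegral_mono fun r => ?_
    by_cases hr : r ∈ Set.Ioi (0:ℝ)
    swap
    · simp only [Set.indicator_of_notMem hr]; exact zero_le
    rw [Set.indicator_of_mem hr]
    have hr0 : 0 < r := hr
    have e : {v | r < max (t1 - l v) 0} = {v | l v < t1 - r} := by
      ext v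
      simp only [Set.mem_ofPred_eq, lt_max_iff]
      constructor
      · rintro (h | h) <;> linarith
      · intro h; left; linarith
    rw [e, Measure.restrict_apply (measurableSet_lt hlm measurable_const), Set.inter_comm]
    by_cases hSr : t1 - r ∈ S
    · have hle := hs _ hSr
      have e2 : G x + s * (t1 - r - x) = W - s * r := by
        rw [ht1]; field_simp; ring
      rw [e2] at hle
      have hGp : 0 < G (t1 - r) := Real.rpow_pos_of_pos hSr _
      have hmem : r ∈ Set.Ioc 0 (W / s) := ⟨hr0, by rw [le_div_iff₀ hspos]; linarith⟩
      rw [Set.indicator_of_mem hmem, ← ofReal_measureReal (hFfin _)]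
      apply ENNReal.ofReal_le_ofReal
      change F (t1 - r) ≤ _
      rw [← hGn]
      exact pow_le_pow_left₀ (hG0 _) hle n
    · have h0 : F (t1 - r) = 0 := le_antisymm (not_lt.1 hSr) (hF0 _)
      have : volume (K ∩ {v | l v < t1 - r}) = 0 := by
        rw [← ofReal_measureReal (hFfin _)]
        change ENNReal.ofReal (F (t1 - r)) = 0
        simp [h0]
      rw [this]; exact zero_le
  have hintm : IntegrableOn (fun v => max (t1 - l v) 0) K :=
    (by fun_prop : Continuous fun v => max (t1 - l v) 0).continuousOn.integrableOn_compact hcomp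
  rw [← ofReal_integral_eq_lintegral_ofReal hintm
    (Filter.Eventually.of_forall fun v => le_max_right _ _),
    ENNReal.ofReal_le_ofReal_iff (by positivity)] at hub
  have hlb : ∫ v in K, (t1 - l v) ≤ ∫ v in K, max (t1 - l v) 0 :=
    integral_mono ((integrableOn_const hfin).sub hIntL) hintm fun v => le_max_left _ _
  rw [hsub] at hlb
  have h5 := hlb.trans hub
  rw [pow_succ, hWn, ht1, add_sub_cancel_left, div_mul_eq_mul_div,
    div_le_div_iff₀ hspos (by positivity)] at h5
  have h6 : (W - G x) * (n + 1) ≤ W := by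
    have : (V * s) * ((W - G x) * (n + 1)) ≤ (V * s) * W := by linarith
    exact le_of_mul_le_mul_left this (by positivity)
  rw [div_mul_eq_mul_div, div_le_iff₀ (by positivity)]
  linarith

noncomputable section

/-- The centroid of a set of positive finite volume. -/
def centroid {n : ℕ} (K : Set (EuclideanSpace ℝ (Fin n))) : EuclideanSpace ℝ (Fin n) :=
  ((volume K).toReal)⁻¹ • ∫ y in K, y

/-- The dot product on ℝⁿ. -/
def dotR {n : ℕ} (v w : EuclideanSpace ℝ (Fin n)) : ℝ := ∑ i, v i * w i

/-- Grünbaum's inequality. -/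
theorem stmt4 {n : ℕ} (K : Set (EuclideanSpace ℝ (Fin n)))
    (hconv : Convex ℝ K) (hcomp : IsCompact K) (hvol : 0 < volume K)
    (w : EuclideanSpace ℝ (Fin n)) (hw : w ≠ 0) (x : ℝ)
    (hcent : dotR (centroid K) w = x) :
    (volume ({v : EuclideanSpace ℝ (Fin n) | x ≤ dotR v w} ∩ K)).toReal ≤
      (1 - ((n : ℝ) / (n + 1)) ^ n) * (volume K).toReal := by
  have hn : n ≠ 0 := by
    rintro rfl
    exact hw (Subsingleton.elim _ _)
  have hd : ∀ v, dotR v w = innerSL ℝ w v := by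
    intro v
    simp [dotR, PiLp.inner_apply]
  have hl : innerSL ℝ w ≠ 0 := by
    intro h
    have := congrArg (fun L => L w) h
    simp at this
    exact hw this
  have hfin : volume K ≠ ∞ := hcomp.measure_lt_top.ne
  have hV0 : 0 < (volume K).toReal := ENNReal.toReal_pos hvol.ne' hfin
  have hid : IntegrableOn (fun y : EuclideanSpace ℝ (Fin n) => y) K :=
    continuous_id.continuousOn.integrableOn_compact hcomp
  have hx : ∫ v in K, innerSL ℝ w v = x * volume.real K := by
    rw [ContinuousLinearMap.integral_comp_comm _ hid, ← hcent, hd, centroid, map_smul, smul_eq_mul,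
      Measure.real]
    field_simp
  have key := grunbaum hn K hconv hcomp hvol (innerSL ℝ w) hl x hx
  have hm : MeasurableSet {v | innerSL ℝ w v < x} :=
    measurableSet_lt (innerSL ℝ w).continuous.measurable measurable_const
  have hsplit := measureReal_inter_add_sdiff (μ := volume) (s := K) hm hfin
  have e : K \ {v | innerSL ℝ w v < x} = {v | x ≤ dotR v w} ∩ K := by
    ext v
    simp only [hd, Set.mem_sdiff, Set.mem_inter_iff, Set.mem_ofPred_eq, not_lt]
    tauto
  rw [e] at hsplit
  simp only [Measure.real] at hsplit key
  linarith
end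
end

section
/- Let R = k[x_0,...,x_n] and let I = (f_1,...,f_n) be a complete intersection ideal of height n generated by homogeneous polynomials of degree d. Then for every positive integer s and every t ≥ (d-1)n + d(s-1), the Hilbert function of R/I^s at degree t equals binomial(n+s-1, n) · d^n. -/
open MvPolynomial

noncomputable section

variable {k : Type*} [Field k]

/-- The Hilbert function of `R/J` for a homogeneous ideal `J ⊆ R = k[x_0,…,x_n]`:
`t ↦ dim_k (R/J)_t`, the dimension of the image of the degree-`t` forms in `R/J`. -/
def hilbFn {n : ℕ} (J : Ideal (MvPolynomial (Fin (n + 1)) k)) (t : ℕ) : ℕ :=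
  Module.finrank k
    ((homogeneousSubmodule (Fin (n + 1)) k t).map
      (Ideal.Quotient.mkₐ k J).toLinearMap)

namespace CIaux
variable {A : Type*} [CommRing A]

/-- `ys` is a weakly regular sequence on `A/K`, expressed with ideals only. -/
def W : Ideal A → List A → Prop
  | _, [] => True
  | K, y :: ys => (∀ a, y * a ∈ K → a ∈ K) ∧ W (K ⊔ Ideal.span {y}) ys

lemma W_top (ys : List A) : W (⊤ : Ideal A) ys := by
  induction ys with
  | nil => trivial
  | cons y ys ih => exact ⟨fun _ _ => trivial, by simpa using ih⟩

lemma mem_sup_span {K : Ideal A} {x a : A} :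
    a ∈ K ⊔ Ideal.span {x} ↔ ∃ k ∈ K, ∃ b, a = k + x * b := by
  rw [Submodule.mem_sup]
  constructor
  · rintro ⟨k, hk, z, hz, rfl⟩
    obtain ⟨b, rfl⟩ := Ideal.mem_span_singleton'.1 hz
    exact ⟨k, hk, b, by ring⟩
  · rintro ⟨k, hk, b, rfl⟩
    exact ⟨k, hk, x * b, Ideal.mul_mem_right _ _ (Ideal.mem_span_singleton_self x), rfl⟩

lemma W_ext (ys : List A) : ∀ (K L : Ideal A) (x : A), (∀ a, x * a ∈ K ↔ a ∈ L) →
    W L ys → W (K ⊔ Ideal.span {x}) ys → W K ys := by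
  induction ys with
  | nil => intros; trivial
  | cons y ys ih =>
    intro K L x h hL hM
    refine ⟨fun a ha => ?_, ih _ (L ⊔ Ideal.span {y}) x (fun a => ⟨fun ha => ?_, fun ha => ?_⟩)
      hL.2 ?_⟩
    · obtain ⟨c, hc, b, rfl⟩ := mem_sup_span.1 (hM.1 a (Ideal.mem_sup_left ha))
      refine K.add_mem hc ((h b).2 (hL.1 b ((h _).1 ?_)))
      have := K.sub_mem ha (K.mul_mem_left y hc)
      convert this using 1; ring
    · obtain ⟨c, hc, b, hb⟩ := mem_sup_span.1 ha
      have h1 : y * b ∈ K ⊔ Ideal.span {x} :=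
        mem_sup_span.2 ⟨-c, K.neg_mem hc, a, by rw [hb]; ring⟩
      obtain ⟨c', hc', e, rfl⟩ := mem_sup_span.1 (hM.1 b h1)
      refine mem_sup_span.2 ⟨a - y * e, (h _).1 ?_, e, by ring⟩
      have : x * (a - y * e) = c + y * c' := by rw [mul_sub, hb]; ring
      rw [this]
      exact K.add_mem hc (K.mul_mem_left y hc')
    · obtain ⟨l, hl, b, rfl⟩ := mem_sup_span.1 ha
      exact mem_sup_span.2 ⟨x * l, (h l).2 hl, x * b, by ring⟩
    · have := hM.2
      rwa [sup_right_comm] at this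

lemma pow_decomp (J : Ideal A) (x : A) (s : ℕ) :
    ∀ a ∈ (J ⊔ Ideal.span {x}) ^ (s + 1),
      ∃ c ∈ J ^ (s + 1), ∃ b ∈ (J ⊔ Ideal.span {x}) ^ s, a = c + x * b := by
  have key : ∀ s, (J ⊔ Ideal.span {x}) ^ (s + 1) ≤
      J ^ (s + 1) ⊔ Ideal.span {x} * (J ⊔ Ideal.span {x}) ^ s := by
    intro s
    induction s with
    | zero => simp
    | succ s ih =>
      set I := J ⊔ Ideal.span {x} with hI
      calc I ^ (s + 1 + 1) = J * I ^ (s + 1) ⊔ Ideal.span {x} * I ^ (s + 1) := by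
            rw [pow_succ' I (s + 1), hI, ← Ideal.sup_mul]
        _ ≤ _ := by
          refine sup_le ?_ le_sup_right
          refine (Ideal.mul_mono_right ih).trans ?_
          rw [Ideal.mul_sup, ← pow_succ']
          refine sup_le_sup_left ?_ _
          rw [mul_left_comm]
          refine Ideal.mul_mono_right ?_
          rw [pow_succ']
          exact Ideal.mul_mono_left le_sup_left
  intro a ha
  obtain ⟨c, hc, z, hz, rfl⟩ := Submodule.mem_sup.1 (key s ha)
  obtain ⟨b, hb, rfl⟩ := Ideal.mem_span_singleton_mul.1 hz
  exact ⟨c, hc, b, hb, rfl⟩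

lemma pow_sup_eq (J : Ideal A) (x : A) (s : ℕ) :
    (J ⊔ Ideal.span {x}) ^ (s + 1) ⊔ Ideal.span {x} = J ^ (s + 1) ⊔ Ideal.span {x} := by
  apply le_antisymm
  · refine sup_le (fun a ha => ?_) le_sup_right
    obtain ⟨c, hc, b, -, rfl⟩ := pow_decomp J x s a ha
    exact mem_sup_span.2 ⟨c, hc, b, rfl⟩
  · exact sup_le_sup_right (Ideal.pow_right_mono le_sup_left _) _

lemma colon (J : Ideal A) (x : A) (s : ℕ) (h : ∀ a, x * a ∈ J ^ (s + 1) → a ∈ J ^ (s + 1))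
    (a : A) : x * a ∈ (J ⊔ Ideal.span {x}) ^ (s + 1) ↔ a ∈ (J ⊔ Ideal.span {x}) ^ s := by
  constructor
  · intro ha
    obtain ⟨c, hc, b, hb, e⟩ := pow_decomp J x s _ ha
    have h1 : a - b ∈ J ^ (s + 1) := h _ (by rw [mul_sub, e]; simpa using hc)
    have h2 : a - b ∈ (J ⊔ Ideal.span {x}) ^ s :=
      Ideal.pow_le_pow_right (Nat.le_succ s) (Ideal.pow_right_mono le_sup_left _ h1)
    simpa using Ideal.add_mem _ h2 hb
  · intro ha
    rw [pow_succ']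
    exact Ideal.mul_mem_mul (Ideal.mem_sup_right (Ideal.mem_span_singleton_self x)) ha

lemma W_pow (rs : List A) : ∀ ys, W ⊥ (rs ++ ys) → ∀ s, W ((Ideal.ofList rs) ^ s) ys := by
  induction rs using List.reverseRecOn with
  | nil =>
    intro ys h s
    cases s with
    | zero => simpa using W_top ys
    | succ s => simpa using h
  | append_singleton rs x ih =>
    intro ys h s
    have h' := ih (x :: ys) (by simpa using h)
    rw [Ideal.ofList_append, Ideal.ofList_singleton]
    induction s with
    | zero => simpa using W_top ys
    | succ s ihs =>
      refine W_ext ys _ _ x (colon _ x s (h' (s + 1)).1) ihs ?_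
      rw [pow_sup_eq]
      exact (h' (s + 1)).2

lemma W_of_isWeaklyRegular (ys : List A) : ∀ pre : List A,
    RingTheory.Sequence.IsWeaklyRegular A (pre ++ ys) → W (Ideal.ofList pre) ys := by
  induction ys with
  | nil => intros; trivial
  | cons y ys ih =>
    intro pre h
    refine ⟨fun a ha => ?_, ?_⟩
    · have h1 := h.regular_mod_prev pre.length (by simp)
      rw [isSMulRegular_quotient_iff_mem_of_smul_mem] at h1
      simpa using h1 a (by simpa using ha)
    · have := ih (pre ++ [y]) (by simpa using h)
      simpa using this
end CIaux
namespace CIaux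
open Polynomial in
/-- The numerator polynomials of the Hilbert series. -/
def B (d : ℕ) : ℕ → ℕ → ℤ[X]
  | _, 0 => 0
  | 0, _ + 1 => 1
  | m + 1, s + 1 => Polynomial.X ^ d * B d (m + 1) s +
      (∑ i ∈ Finset.range d, Polynomial.X ^ i) * B d m (s + 1)

lemma B_zero (d m : ℕ) : B d m 0 = 0 := by cases m <;> rw [B]

lemma B_natDegree (d : ℕ) (hd : 0 < d) : ∀ m s,
    (B d m (s + 1)).natDegree ≤ (d - 1) * m + d * s := by
  have hG : (∑ i ∈ Finset.range d, (Polynomial.X : Polynomial ℤ) ^ i).natDegree ≤ d - 1 := by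
    refine Polynomial.natDegree_sum_le_of_forall_le _ _ fun i hi => ?_
    rw [Polynomial.natDegree_X_pow]
    have := Finset.mem_range.1 hi
    omega
  intro m
  induction m with
  | zero => intro s; simp [B]
  | succ m ihm =>
    intro s
    have h2 : ∀ s, ((∑ i ∈ Finset.range d, (Polynomial.X : Polynomial ℤ) ^ i) *
        B d m (s + 1)).natDegree ≤ (d - 1) * (m + 1) + d * s := fun s =>
      (Polynomial.natDegree_mul_le_of_le hG (ihm s)).trans (by rw [mul_add]; omega)
    induction s with
    | zero => rw [B, B_zero, mul_zero, zero_add]; exact h2 0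
    | succ s ihs =>
      rw [B]
      refine Polynomial.natDegree_add_le_of_degree_le ?_ (h2 _)
      refine (Polynomial.natDegree_mul_le_of_le (Polynomial.natDegree_X_pow_le d) ihs).trans ?_
      rw [mul_add d s]; omega

lemma B_eval (d : ℕ) : ∀ m s, (B d m (s + 1)).eval 1 = ((m + s).choose m * d ^ m : ℕ) := by
  intro m
  induction m with
  | zero => intro s; simp [B]
  | succ m ihm =>
    intro s
    induction s with
    | zero =>
      rw [B, B_zero, mul_zero, zero_add, Polynomial.eval_mul, ihm]
      simp [Polynomial.eval_finsetSum, pow_succ']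
    | succ s ihs =>
      rw [B, Polynomial.eval_add, Polynomial.eval_mul, Polynomial.eval_mul, ihm, ihs]
      have : (m + 1 + (s + 1)).choose (m + 1) =
          (m + (s + 1)).choose m + (m + 1 + s).choose (m + 1) := by
        rw [show m + 1 + (s + 1) = (m + (s + 1)) + 1 by ring, Nat.choose_succ_succ,
          show m + (s + 1) = m + 1 + s by ring]
      rw [this]
      simp [Polynomial.eval_finsetSum, pow_succ']
      ring

lemma coeff_of_mul_one_sub (P : PowerSeries ℤ) (b : Polynomial ℤ)
    (h : P * (1 - PowerSeries.X) = (b : PowerSeries ℤ)) (t : ℕ) (ht : b.natDegree ≤ t) :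
    PowerSeries.coeff t P = b.eval 1 := by
  have h1 : P = (b : PowerSeries ℤ) * PowerSeries.mk 1 := by
    rw [← h, mul_assoc, mul_comm (1 - PowerSeries.X), PowerSeries.mk_one_mul_one_sub_eq_one,
      mul_one]
  rw [h1, PowerSeries.coeff_mul, Finset.Nat.sum_antidiagonal_eq_sum_range_succ_mk,
    Polynomial.eval_eq_sum_range' (Nat.lt_succ_of_le ht)]
  simp

variable {n : ℕ}

lemma finrank_map_add {V V' : Type*} [AddCommGroup V] [AddCommGroup V'] [Module k V] [Module k V']
    (p : Submodule k V) [FiniteDimensional k p] (φ : V →ₗ[k] V') :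
    Module.finrank k (p.map φ) + Module.finrank k (p ⊓ LinearMap.ker φ : Submodule k V)
      = Module.finrank k p := by
  rw [← LinearMap.finrank_range_add_finrank_ker (φ.domRestrict p), LinearMap.range_domRestrict,
    LinearMap.ker_domRestrict, ← Submodule.finrank_map_subtype_eq,
    Submodule.map_comap_subtype]

instance (t : ℕ) : FiniteDimensional k (homogeneousSubmodule (Fin (n + 1)) k t) :=
  Module.Finite.of_fg (homogeneousSubmodule_fg _ _ t)

lemma finrank_map_of_ker {V V' V'' : Type*} [AddCommGroup V] [AddCommGroup V'] [AddCommGroup V'']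
    [Module k V] [Module k V'] [Module k V'']
    (p : Submodule k V) [FiniteDimensional k p] (φ : V →ₗ[k] V') (ψ : V →ₗ[k] V'')
    (h : LinearMap.ker φ = LinearMap.ker ψ) :
    Module.finrank k (p.map φ) = Module.finrank k (p.map ψ) := by
  have h1 := finrank_map_add p φ
  have h2 := finrank_map_add p ψ
  rw [h] at h1
  omega

attribute [local instance] MvPolynomial.gradedAlgebra

lemma comp_mul (x b : MvPolynomial (Fin (n + 1)) k) (d u : ℕ) (hx : x.IsHomogeneous d) :
    homogeneousComponent u (x * b) =
      if d ≤ u then x * homogeneousComponent (u - d) b else 0 := by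
  conv_lhs => rw [← sum_homogeneousComponent b, Finset.mul_sum, map_sum]
  have h : ∀ i, homogeneousComponent u (x * homogeneousComponent i b) =
      if d + i = u then x * homogeneousComponent i b else 0 := by
    intro i
    have := homogeneousComponent_of_mem (m := u) (n := d + i)
      (hx.mul (homogeneousComponent_isHomogeneous i b))
    rw [this]; simp [eq_comm]
  simp_rw [h]
  split_ifs with hdu
  · have : ∀ i, (d + i = u) ↔ (i = u - d) := fun i => by omega
    simp_rw [this]
    rw [Finset.sum_ite_eq']
    split_ifs with h3
    · rfl
    · rw [homogeneousComponent_eq_zero _ _ (by simp at h3; omega), mul_zero]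
  · exact Finset.sum_eq_zero fun i _ => if_neg (by omega)

lemma hilb_small (K : Ideal (MvPolynomial (Fin (n + 1)) k)) (x : MvPolynomial (Fin (n + 1)) k)
    (d t : ℕ) (hx : x.IsHomogeneous d)
    (hK : K.IsHomogeneous (homogeneousSubmodule (Fin (n + 1)) k)) (ht : t < d) :
    hilbFn K t = hilbFn (K ⊔ Ideal.span {x}) t := by
  have h1 := finrank_map_add (homogeneousSubmodule (Fin (n + 1)) k t)
    (Ideal.Quotient.mkₐ k K).toLinearMap
  have h2 := finrank_map_add (homogeneousSubmodule (Fin (n + 1)) k t)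
    (Ideal.Quotient.mkₐ k (K ⊔ Ideal.span {x})).toLinearMap
  have h3 : (homogeneousSubmodule (Fin (n + 1)) k t ⊓
      LinearMap.ker (Ideal.Quotient.mkₐ k K).toLinearMap) =
      (homogeneousSubmodule (Fin (n + 1)) k t ⊓
      LinearMap.ker (Ideal.Quotient.mkₐ k (K ⊔ Ideal.span {x})).toLinearMap) := by
    ext r
    simp only [Submodule.mem_inf, LinearMap.mem_ker, AlgHom.toLinearMap_apply,
      Ideal.Quotient.mkₐ_eq_mk, Ideal.Quotient.eq_zero_iff_mem]
    refine and_congr_right fun hr => ⟨fun h => Ideal.mem_sup_left h, fun h => ?_⟩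
    obtain ⟨c, hc, b, rfl⟩ := mem_sup_span.1 h
    rw [← homogeneousComponent_eq_self hr, map_add, comp_mul x b d t hx, if_neg (by omega),
      add_zero]
    exact homogeneousComponent_mem_of_mem hK hc t
  rw [h3] at h1
  unfold hilbFn
  omega

lemma hilb_large (K L : Ideal (MvPolynomial (Fin (n + 1)) k)) (x : MvPolynomial (Fin (n + 1)) k)
    (d t : ℕ) (hx : x.IsHomogeneous d)
    (hK : K.IsHomogeneous (homogeneousSubmodule (Fin (n + 1)) k))
    (hL : ∀ a, x * a ∈ K ↔ a ∈ L) :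
    hilbFn K (t + d) = hilbFn L t + hilbFn (K ⊔ Ideal.span {x}) (t + d) := by
  let φ : MvPolynomial (Fin (n + 1)) k →ₗ[k] MvPolynomial (Fin (n + 1)) k ⧸ K := (Ideal.Quotient.mkₐ k K).toLinearMap ∘ₗ LinearMap.mulLeft k x
  let fac : MvPolynomial (Fin (n + 1)) k ⧸ K →ₗ[k] MvPolynomial (Fin (n + 1)) k ⧸ (K ⊔ Ideal.span {x}) :=
    (Ideal.Quotient.factorₐ k (le_sup_left : K ≤ K ⊔ Ideal.span {x})).toLinearMap
  have h1 := finrank_map_add ((homogeneousSubmodule (Fin (n + 1)) k (t + d)).map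
    (Ideal.Quotient.mkₐ k K).toLinearMap) fac
  have h2 : Module.finrank k ((homogeneousSubmodule (Fin (n + 1)) k t).map φ) = hilbFn L t := by
    refine finrank_map_of_ker _ _ _ ?_
    ext a
    simp only [LinearMap.mem_ker, AlgHom.toLinearMap_apply, φ, LinearMap.comp_apply,
      LinearMap.mulLeft_apply,
      Ideal.Quotient.mkₐ_eq_mk, Ideal.Quotient.eq_zero_iff_mem]
    exact hL a
  have h3 : ((homogeneousSubmodule (Fin (n + 1)) k (t + d)).map
    (Ideal.Quotient.mkₐ k K).toLinearMap) ⊓ LinearMap.ker fac =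
      (homogeneousSubmodule (Fin (n + 1)) k t).map φ := by
    ext z
    constructor
    · rintro ⟨⟨r, hr, rfl⟩, hz⟩
      have hz' : r ∈ K ⊔ Ideal.span {x} := Ideal.Quotient.eq_zero_iff_mem.1 hz
      obtain ⟨c, hc, b, rfl⟩ := mem_sup_span.1 hz'
      have h5 : c + x * b = homogeneousComponent (t + d) c + x * homogeneousComponent t b := by
        rw [← homogeneousComponent_eq_self hr, map_add, comp_mul x b d _ hx, if_pos (by omega),
          Nat.add_sub_cancel]
      refine ⟨homogeneousComponent t b, homogeneousComponent_mem _ _, ?_⟩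
      rw [h5]
      refine Ideal.Quotient.eq.2 ?_
      have := K.neg_mem (homogeneousComponent_mem_of_mem hK hc (t + d))
      simpa using this
    · rintro ⟨b, hb, rfl⟩
      refine ⟨⟨x * b, ?_, rfl⟩, ?_⟩
      · have := hx.mul hb
        rwa [add_comm d t] at this
      · refine Ideal.Quotient.eq_zero_iff_mem.2 ?_
        exact Ideal.mem_sup_right (Ideal.mul_mem_right _ _ (Ideal.mem_span_singleton_self x))
  have h4 : ((homogeneousSubmodule (Fin (n + 1)) k (t + d)).map
    (Ideal.Quotient.mkₐ k K).toLinearMap).map fac =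
      (homogeneousSubmodule (Fin (n + 1)) k (t + d)).map
    (Ideal.Quotient.mkₐ k (K ⊔ Ideal.span {x})).toLinearMap := by
    rw [← Submodule.map_comp]; rfl
  rw [h3, h4, h2] at h1
  unfold hilbFn at *
  omega

/-- The Hilbert series. -/
def HS (K : Ideal (MvPolynomial (Fin (n + 1)) k)) : PowerSeries ℤ :=
  PowerSeries.mk fun t => (hilbFn K t : ℤ)

lemma HS_rec (K L : Ideal (MvPolynomial (Fin (n + 1)) k)) (x : MvPolynomial (Fin (n + 1)) k)
    (d : ℕ) (hx : x.IsHomogeneous d)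
    (hK : K.IsHomogeneous (homogeneousSubmodule (Fin (n + 1)) k))
    (hL : ∀ a, x * a ∈ K ↔ a ∈ L) :
    HS K = PowerSeries.X ^ d * HS L + HS (K ⊔ Ideal.span {x}) := by
  ext t
  rw [map_add, PowerSeries.coeff_X_pow_mul']
  simp only [HS, PowerSeries.coeff_mk]
  split_ifs with h
  · obtain ⟨u, rfl⟩ := Nat.exists_eq_add_of_le' h
    rw [hilb_large K L x d u hx hK hL]
    simp
  · rw [hilb_small K x d t hx hK (by omega), zero_add]

lemma HS_top : HS (⊤ : Ideal (MvPolynomial (Fin (n + 1)) k)) = 0 := by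
  ext t
  simp only [HS, PowerSeries.coeff_mk, map_zero, Nat.cast_eq_zero, hilbFn]
  exact Module.finrank_zero_of_subsingleton

lemma finrank_hom (t : ℕ) :
    Module.finrank k (homogeneousSubmodule (Fin (n + 1)) k t) = (n + t).choose n := by
  rw [homogeneousSubmodule_eq_finsupp_supported]
  have e : (AddMonoidAlgebra.supported k k {d : Fin (n + 1) →₀ ℕ | d.degree = t}) ≃ₗ[k]
      ({d : Fin (n + 1) →₀ ℕ | d.degree = t} →₀ k) := by
    rw [AddMonoidAlgebra.supported_eq_map]
    exact ((AddMonoidAlgebra.coeffLinearEquiv k).symm.submoduleMap _).symm ≪≫ₗ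
      Finsupp.supportedEquivFinsupp _
  have hs : {d : Fin (n + 1) →₀ ℕ | d.degree = t} =
      (Finset.finsuppAntidiag (Finset.univ : Finset (Fin (n + 1))) t : Set _) := by
    ext d
    simp [Finsupp.degree_eq_sum]
  rw [e.finrank_eq, hs]
  rw [Module.finrank_finsupp_self]
  simp only [Finset.coe_sort_coe, Fintype.card_coe]
  rw [Finset.card_finsuppAntidiag_nat_eq_choose]
  simp only [Finset.card_univ, Fintype.card_fin]
  rw [show n + 1 + t - 1 = n + t by omega, Nat.choose_symm_add]

lemma HS_bot : HS (⊥ : Ideal (MvPolynomial (Fin (n + 1)) k)) *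
    (1 - PowerSeries.X) ^ (n + 1) = 1 := by
  have : HS (⊥ : Ideal (MvPolynomial (Fin (n + 1)) k)) =
      PowerSeries.mk fun t => ((n + t).choose n : ℤ) := by
    ext t
    simp only [HS, PowerSeries.coeff_mk, hilbFn]
    rw [← finrank_hom (k := k)]
    congr 1
    have h := finrank_map_of_ker (homogeneousSubmodule (Fin (n + 1)) k t)
      (Ideal.Quotient.mkₐ k (⊥ : Ideal (MvPolynomial (Fin (n + 1)) k))).toLinearMap
      LinearMap.id (by
        ext a
        simp only [LinearMap.mem_ker, AlgHom.toLinearMap_apply, 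
          Ideal.Quotient.mkₐ_eq_mk, Ideal.Quotient.eq_zero_iff_mem]
        simp)
    rw [h, Submodule.map_id]
  rw [this]
  exact (PowerSeries.invOneSubPow ℤ (n + 1)).val_inv

lemma isHom_pow {d : ℕ} (rs : List (MvPolynomial (Fin (n + 1)) k))
    (h : ∀ x ∈ rs, x.IsHomogeneous d) (s : ℕ) :
    ((Ideal.ofList rs) ^ s).IsHomogeneous (homogeneousSubmodule (Fin (n + 1)) k) := by
  induction s with
  | zero => rw [pow_zero, Ideal.one_eq_top]; exact Ideal.IsHomogeneous.top _
  | succ s ih =>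
    rw [pow_succ]
    exact ih.mul (Ideal.homogeneous_span _ _ fun x hx => ⟨d, h x hx⟩)

lemma HS_main {d : ℕ} (rs : List (MvPolynomial (Fin (n + 1)) k)) :
    (∀ x ∈ rs, x.IsHomogeneous d) → ∀ ys, W ⊥ (rs ++ ys) → ∀ e, rs.length + e = n → ∀ s,
    HS ((Ideal.ofList rs) ^ s) * (1 - PowerSeries.X) ^ (e + 1) =
      (B d rs.length s : PowerSeries ℤ) := by
  induction rs using List.reverseRecOn with
  | nil =>
    intro _ ys _ e he s
    obtain rfl : e = n := by simpa using he
    cases s with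
    | zero => rw [pow_zero, Ideal.one_eq_top, HS_top, B_zero]; simp
    | succ s => simpa [B] using HS_bot
  | append_singleton rs x ih =>
    intro hh ys hW e he s
    have hx : x.IsHomogeneous d := hh x (by simp)
    have hh' : ∀ y ∈ rs, y.IsHomogeneous d := fun y hy => hh y (by simp [hy])
    have hW' : W ⊥ (rs ++ (x :: ys)) := by simpa using hW
    have ih' := ih hh' _ hW' (e + 1) (by simp at he; omega)
    rw [List.length_append, List.length_singleton]
    induction s with
    | zero => rw [pow_zero, Ideal.one_eq_top, HS_top, B_zero]; simp
    | succ s ihs =>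
      have hreg := (W_pow rs _ hW' (s + 1)).1
      have h1 := HS_rec ((Ideal.ofList (rs ++ [x])) ^ (s + 1)) ((Ideal.ofList (rs ++ [x])) ^ s)
        x d hx (isHom_pow _ hh _) (by
          rw [Ideal.ofList_append, Ideal.ofList_singleton]
          exact colon _ x s hreg)
      have h2 := HS_rec ((Ideal.ofList rs) ^ (s + 1)) ((Ideal.ofList rs) ^ (s + 1)) x d hx
        (isHom_pow _ hh' _) (fun a => ⟨hreg a, fun h => Ideal.mul_mem_left _ _ h⟩)
      have h3 : (Ideal.ofList (rs ++ [x])) ^ (s + 1) ⊔ Ideal.span {x} =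
          (Ideal.ofList rs) ^ (s + 1) ⊔ Ideal.span {x} := by
        rw [Ideal.ofList_append, Ideal.ofList_singleton, pow_sup_eq]
      rw [h3] at h1
      have h4 := ih' (s + 1)
      have hG : (∑ i ∈ Finset.range d, (PowerSeries.X : PowerSeries ℤ) ^ i) *
          (1 - PowerSeries.X) = 1 - PowerSeries.X ^ d := geom_sum_mul_neg _ _
      have hB : (B d (rs.length + 1) (s + 1) : PowerSeries ℤ) =
          PowerSeries.X ^ d * (B d (rs.length + 1) s : PowerSeries ℤ) +
          (∑ i ∈ Finset.range d, (PowerSeries.X : PowerSeries ℤ) ^ i) *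
            (B d rs.length (s + 1) : PowerSeries ℤ) := by
        rw [B]
        have hsum : ((∑ i ∈ Finset.range d, (Polynomial.X : Polynomial ℤ) ^ i : Polynomial ℤ) :
            PowerSeries ℤ) = ∑ i ∈ Finset.range d, (PowerSeries.X : PowerSeries ℤ) ^ i := by
          rw [← Polynomial.coeToPowerSeries.ringHom_apply, map_sum]
          simp
        rw [Polynomial.coe_add, Polynomial.coe_mul, Polynomial.coe_mul, hsum, Polynomial.coe_pow,
          Polynomial.coe_X]
      rw [hB, ← ihs, ← h4, h1]
      have h5 : HS ((Ideal.ofList rs) ^ (s + 1) ⊔ Ideal.span {x}) =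
        (1 - PowerSeries.X ^ d) * HS ((Ideal.ofList rs) ^ (s + 1)) := by
          linear_combination -h2
      rw [h5, ← hG]
      ring

end CIaux

theorem stmt8 {n d : ℕ} (hd : 0 < d)
    (f : Fin n → MvPolynomial (Fin (n + 1)) k)
    (hhom : ∀ i, (f i).IsHomogeneous d)
    (hreg : RingTheory.Sequence.IsRegular (MvPolynomial (Fin (n + 1)) k)
      (List.ofFn f))
    (I : Ideal (MvPolynomial (Fin (n + 1)) k))
    (hI : I = Ideal.span (Set.range f))
    (s t : ℕ) (hs : 0 < s) (ht : (d - 1) * n + d * (s - 1) ≤ t) :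
    hilbFn (I ^ s) t = (n + s - 1).choose n * d ^ n := by
  have hrs : Ideal.ofList (List.ofFn f) = I := by
    rw [hI]
    refine congrArg Ideal.span (Set.ext fun r => ?_)
    exact List.mem_ofFn' f r
  have hW : CIaux.W (⊥ : Ideal (MvPolynomial (Fin (n + 1)) k)) (List.ofFn f ++ []) := by
    have := CIaux.W_of_isWeaklyRegular (List.ofFn f) [] hreg.toIsWeaklyRegular
    simpa using this
  have h := CIaux.HS_main (d := d) (List.ofFn f) (by
    intro x hx
    obtain ⟨i, rfl⟩ := (List.mem_ofFn' _ _).1 hx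
    exact hhom i) [] hW 0 (by simp) s
  rw [hrs, List.length_ofFn, zero_add, pow_one] at h
  obtain ⟨s, rfl⟩ : ∃ u, s = u + 1 := ⟨s - 1, by omega⟩
  have h2 := CIaux.coeff_of_mul_one_sub _ _ h t ((CIaux.B_natDegree d hd n s).trans (by simpa using ht))
  rw [CIaux.B_eval, CIaux.HS, PowerSeries.coeff_mk] at h2
  rw [show n + (s + 1) - 1 = n + s by omega]
  exact_mod_cast h2
end
end

section
/- Let R = k[x_0,...,x_n] over a field k of characteristic p > 0, and let I ⊆ R be an ideal generated by d-forms with height h. The following are equivalent: (i) ess(I) = h; (ii) the integral closure of I equals (x_0,...,x_{h-1})^d after a linear change of coordinates; (iii) I ⊆ (x_0,...,x_{h-1})^d after a linear change of coordinates. -/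
open MvPolynomial

noncomputable section

variable {k : Type*} [Field k]

/-- The integral closure of an ideal `I`, as a set: elements satisfying an equation
`x^m + a_1 x^{m-1} + … + a_m = 0` with `a_i ∈ I^i`. -/
def intCl {R : Type*} [CommRing R] (I : Ideal R) : Set R :=
  {x | ∃ m : ℕ, 0 < m ∧ ∃ a : ℕ → R,
    (∀ i ∈ Finset.Icc 1 m, a i ∈ I ^ i) ∧
    x ^ m + ∑ i ∈ Finset.Icc 1 m, a i * x ^ (m - i) = 0}

/-- The linear change of coordinates on `k[x_0,…,x_n]` given by a matrix `M`. -/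
def coordChange {n : ℕ} (M : Matrix (Fin (n + 1)) (Fin (n + 1)) k) :
    MvPolynomial (Fin (n + 1)) k →ₐ[k] MvPolynomial (Fin (n + 1)) k :=
  aeval fun i => ∑ j, MvPolynomial.C (M i j) * X j

/-- The ideal `(x_0,…,x_{h-1})`. -/
def varIdeal {n : ℕ} (k : Type*) [Field k] (h : ℕ) : Ideal (MvPolynomial (Fin (n + 1)) k) :=
  Ideal.span {f | ∃ i : Fin (n + 1), (i : ℕ) < h ∧ f = X i}

/-- weights: `1` on the first `h` variables and `0` on the others -/
def wt (n h : ℕ) : Fin (n + 1) → ℕ := fun i => if (i : ℕ) < h then 1 else 0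

/-- weighted order -/
def wo {n : ℕ} (h : ℕ) (f : MvPolynomial (Fin (n + 1)) k) : ℕ∞ :=
  (f : MvPowerSeries (Fin (n + 1)) k).weightedOrder (wt n h)

lemma wo_mul {n h : ℕ} (f g : MvPolynomial (Fin (n + 1)) k) : wo h (f * g) = wo h f + wo h g := by
  unfold wo
  rw [MvPolynomial.coe_mul, MvPowerSeries.weightedOrder_mul]

lemma le_wo_iff {n h e : ℕ} (f : MvPolynomial (Fin (n + 1)) k) :
    (e : ℕ∞) ≤ wo h f ↔ ∀ u, coeff u f ≠ 0 → e ≤ Finsupp.weight (wt n h) u := by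
  constructor
  · intro H u hu
    have := MvPowerSeries.weightedOrder_le (wt n h) (f := (f : MvPowerSeries (Fin (n + 1)) k))
      (d := u) (by simpa using hu)
    exact_mod_cast H.trans this
  · intro H
    apply MvPowerSeries.nat_le_weightedOrder
    intro u hu
    by_contra hc
    have := H u (by simpa using hc)
    omega

lemma wo_one {n h : ℕ} : wo h (1 : MvPolynomial (Fin (n + 1)) k) = 0 := by
  unfold wo; simp

lemma wo_pow {n h : ℕ} (f : MvPolynomial (Fin (n + 1)) k) (m : ℕ) : wo h (f ^ m) = m * wo h f := by
  induction m with
  | zero => simp [wo_one]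
  | succ m ih => rw [pow_succ, wo_mul, ih]; push_cast; ring

/-- ideal of elements of weighted order at least `e` -/
def woIdeal (n : ℕ) (k : Type*) [Field k] (h e : ℕ) : Ideal (MvPolynomial (Fin (n + 1)) k) where
  carrier := {f | (e : ℕ∞) ≤ wo h f}
  add_mem' := by
    intro a b ha hb
    have := MvPowerSeries.min_weightedOrder_le_add (wt n h)
      (f := (a : MvPowerSeries (Fin (n + 1)) k)) (g := (b : MvPowerSeries (Fin (n + 1)) k))
    rw [← MvPolynomial.coe_add] at this
    exact (le_min ha hb).trans this
  zero_mem' := by simp [wo]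
  smul_mem' := by
    intro c x hx
    simp only [Set.mem_ofPred_eq, smul_eq_mul, wo_mul] at *
    exact hx.trans le_add_self

lemma mem_woIdeal {n h e : ℕ} {f : MvPolynomial (Fin (n + 1)) k} :
    f ∈ woIdeal n k h e ↔ (e : ℕ∞) ≤ wo h f := Iff.rfl

lemma X_mem_varIdeal {n h : ℕ} {i : Fin (n + 1)} (hi : (i : ℕ) < h) :
    (X i : MvPolynomial (Fin (n + 1)) k) ∈ (varIdeal k h : Ideal (MvPolynomial (Fin (n + 1)) k)) :=
  Ideal.subset_span ⟨i, hi, rfl⟩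

lemma varIdeal_pow {n h e : ℕ} : (varIdeal k h : Ideal (MvPolynomial (Fin (n + 1)) k)) ^ e
    = woIdeal n k h e := by
  apply le_antisymm
  · induction e with
    | zero => intro f _; simp [mem_woIdeal]
    | succ e ih =>
      rw [pow_succ, Ideal.mul_le]
      intro r hr s hs
      have h1 := mem_woIdeal.1 (ih hr)
      have h2 : (varIdeal k h : Ideal (MvPolynomial (Fin (n + 1)) k)) ≤ woIdeal n k h 1 := by
        unfold varIdeal
        rw [Ideal.span_le]
        rintro _ ⟨i, hi, rfl⟩
        rw [SetLike.mem_coe, mem_woIdeal, le_wo_iff]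
        intro u hu
        rw [coeff_X] at hu
        have : u = Finsupp.single i 1 := by
          by_contra hc; exact hu (if_neg (fun h => hc h.symm))
        rw [this]
        simp [Finsupp.weight_apply, wt, hi]
      have h3 := mem_woIdeal.1 (h2 hs)
      rw [mem_woIdeal, wo_mul]
      push_cast
      exact add_le_add h1 (by exact_mod_cast h3)
  · intro f hf
    rw [mem_woIdeal, le_wo_iff] at hf
    rw [f.as_sum]
    refine Ideal.sum_mem _ fun u hu => ?_
    have hu' := hf u (by simpa using hu)
    refine Ideal.pow_le_pow_right hu' ?_
    rw [monomial_eq, Finsupp.prod_fintype _ _ (by simp)]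
    apply Ideal.mul_mem_left
    rw [Finsupp.weight_apply, Finsupp.sum_fintype _ _ (by simp), ← Finset.prod_pow_eq_pow_sum]
    refine Ideal.prod_mem_prod fun i _ => ?_
    by_cases hi : (i : ℕ) < h
    · simp only [wt, hi, if_true, smul_eq_mul, mul_one]
      exact Ideal.pow_mem_pow (X_mem_varIdeal hi) _
    · simp [wt, hi]

lemma mem_varIdeal_pow {n h e : ℕ} {f : MvPolynomial (Fin (n + 1)) k} :
    f ∈ (varIdeal k h : Ideal (MvPolynomial (Fin (n + 1)) k)) ^ e ↔
    ∀ u, coeff u f ≠ 0 → e ≤ Finsupp.weight (wt n h) u := by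
  rw [varIdeal_pow, mem_woIdeal, le_wo_iff]

lemma intCl_subset {n h d : ℕ} (I : Ideal (MvPolynomial (Fin (n + 1)) k))
    (hI : I ≤ (varIdeal k h) ^ d) {x : MvPolynomial (Fin (n + 1)) k} (hx : x ∈ intCl I) :
    x ∈ (varIdeal k h : Ideal (MvPolynomial (Fin (n + 1)) k)) ^ d := by
  obtain ⟨m, hm, a, ha, h0⟩ := hx
  rw [varIdeal_pow, mem_woIdeal]
  by_contra! hlt
  obtain ⟨e, he⟩ := ENat.ne_top_iff_exists.1 (ne_top_of_lt hlt)
  rw [← he] at hlt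
  have hlt' : e < d := by exact_mod_cast hlt
  have hsum : (∑ i ∈ Finset.Icc 1 m, a i * x ^ (m - i)) ∈ woIdeal n k h (m * e + 1) := by
    refine Ideal.sum_mem _ fun i hi => ?_
    have h1 : a i ∈ woIdeal n k h (d * i) := by
      rw [← varIdeal_pow, pow_mul]
      exact Ideal.pow_right_mono hI _ (ha i hi)
    rw [mem_woIdeal] at h1 ⊢
    rw [wo_mul, wo_pow, ← he]
    refine le_trans ?_ (add_le_add_left h1 _)
    rw [Finset.mem_Icc] at hi
    obtain ⟨j, rfl⟩ := Nat.exists_eq_add_of_le hi.2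
    norm_cast
    rw [Nat.add_sub_cancel_left]
    nlinarith
  have hx : x ^ m ∈ woIdeal n k h (m * e + 1) := by
    rw [eq_neg_of_add_eq_zero_left h0]
    exact neg_mem hsum
  rw [mem_woIdeal, wo_pow, ← he] at hx
  norm_cast at hx
  omega


lemma intCl_of_mul {R : Type*} [CommRing R] [IsDomain R] [IsNoetherianRing R]
    (I N : Ideal R) (hN : N ≠ ⊥) (x : R) (hx : ∀ y ∈ N, x * y ∈ I * N) : x ∈ intCl I := by
  let f : Module.End R N := algebraMap R (Module.End R N) x
  obtain ⟨P, hP, -, hc, hz⟩ :=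
    LinearMap.exists_monic_and_natDegree_eq_and_coeff_mem_pow_and_aeval_eq_zero R f I (by
      rintro _ ⟨y, rfl⟩
      have h1 := hx y y.2
      have h2 : Submodule.map N.subtype (I • (⊤ : Submodule R N)) = I * N := by
        rw [Submodule.map_smul'']; simp
      rw [← h2] at h1
      obtain ⟨z, hz, hz'⟩ := h1
      have : f y = z := by
        apply Subtype.ext
        rw [← Submodule.subtype_apply, ← Submodule.subtype_apply, hz']
        simp [f]
      rw [this]; exact hz)
  have hev : P.eval x = 0 := by
    rw [Polynomial.aeval_algebraMap_apply] at hz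
    obtain ⟨y, hy, hy0⟩ := Submodule.exists_mem_ne_zero_of_ne_bot hN
    have := congrArg (fun g : Module.End R N => ((g ⟨y, hy⟩ : N) : R)) hz
    simp at this
    exact this.resolve_right hy0
  have hpos : 0 < P.natDegree := by
    rw [Nat.pos_iff_ne_zero]
    intro h0
    rw [hP.natDegree_eq_zero] at h0
    simp [h0] at hev
  refine ⟨P.natDegree, hpos, fun i => P.coeff (P.natDegree - i), ?_, ?_⟩
  · intro i hi
    have := hc (P.natDegree - i)
    rw [Finset.mem_Icc] at hi
    rwa [Nat.sub_sub_self hi.2] at this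
  · rw [Polynomial.eval_eq_sum_range, ← Finset.sum_flip, Finset.range_eq_Ico,
      Finset.sum_eq_sum_Ico_succ_bot (by omega)] at hev
    have e : Finset.Icc 1 P.natDegree = Finset.Ico (0 + 1) (P.natDegree + 1) := by
      rfl
    rw [e]
    simpa [hP.coeff_natDegree] using hev

lemma idealHeight_eq {R : Type*} [CommRing R] (I : Ideal R) : idealHeight I = I.height := by
  unfold idealHeight
  apply le_antisymm
  · rw [Ideal.height_eq_inf_minimalPrimes]
    refine le_iInf₂ fun J hJ => ?_
    have := hJ.1.1
    refine (iInf₂_le (⟨J, this⟩ : PrimeSpectrum R) hJ.1.2).trans ?_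
    rw [← PrimeSpectrum.height_eq_orderHeight]
  · refine le_iInf₂ fun J hJ => ?_
    rw [← PrimeSpectrum.height_eq_orderHeight]
    exact Ideal.height_mono hJ

/-- a weighted homogeneous substitution -/
def thetaMap {n : ℕ} (h : ℕ) (q : Ideal (MvPolynomial (Fin (n + 1)) k)) (i₀ : Fin (n + 1)) :
    MvPolynomial (Fin (n + 1)) k →ₐ[k]
      MvPolynomial (Fin (n + 1)) (MvPolynomial (Fin (n + 1)) k ⧸ q) :=
  aeval fun j => if (j : ℕ) < h then X i₀ * C (Ideal.Quotient.mk q (X j)) else X j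

lemma homog_weight {n h d : ℕ} {f : MvPolynomial (Fin (n + 1)) k} (hf : f.IsHomogeneous d)
    (hm : f ∈ (varIdeal k h : Ideal (MvPolynomial (Fin (n + 1)) k)) ^ d) :
    (∀ u, coeff u f ≠ 0 → ∀ i, u i ≠ 0 → (i : ℕ) < h) ∧ IsWeightedHomogeneous (wt n h) f d := by
  rw [mem_varIdeal_pow] at hm
  have key : ∀ u, coeff u f ≠ 0 → ∀ i, u i ≠ 0 → (i : ℕ) < h := by
    intro u hu i hi
    by_contra hc
    have h1 := hm u hu
    have h2 := hf hu
    rw [Finsupp.weight_apply, Finsupp.sum_fintype _ _ (by simp)] at h1 h2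
    have : ∑ i, u i • wt n h i < ∑ i, u i • (1 : Fin (n + 1) → ℕ) i := by
      refine Finset.sum_lt_sum (fun j _ => ?_) ⟨i, Finset.mem_univ _, ?_⟩
      · unfold wt; split_ifs <;> simp
      · simp [wt, hc, Nat.pos_iff_ne_zero, hi]
    omega
  refine ⟨key, fun u hu => ?_⟩
  rw [← hf hu, Finsupp.weight_apply, Finsupp.weight_apply]
  refine Finsupp.sum_congr fun i hi => ?_
  simp [wt, key u hu i (by simpa using hi)]

lemma theta_homog {n h d : ℕ} (q : Ideal (MvPolynomial (Fin (n + 1)) k)) (i₀ : Fin (n + 1))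
    {f : MvPolynomial (Fin (n + 1)) k} (hf : f.IsHomogeneous d)
    (hm : f ∈ (varIdeal k h : Ideal (MvPolynomial (Fin (n + 1)) k)) ^ d) :
    thetaMap h q i₀ f = X i₀ ^ d * C (Ideal.Quotient.mk q f) := by
  obtain ⟨hs, -⟩ := homog_weight hf hm
  have e1 : Ideal.Quotient.mk q f = aeval (fun j => Ideal.Quotient.mk q (X j)) f := by
    have : Ideal.Quotient.mkₐ k q = aeval (fun j => Ideal.Quotient.mk q (X j)) := by
      apply MvPolynomial.algHom_ext; intro i; simp
    rw [← this]; rfl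
  rw [e1, thetaMap, aeval_def, aeval_def, eval₂_eq', eval₂_eq', map_sum, Finset.mul_sum]
  refine Finset.sum_congr rfl fun u hu => ?_
  have hu' : coeff u f ≠ 0 := by simpa using hu
  have hd : ∑ i, u i = d := by
    have := hf hu'
    rw [Finsupp.weight_apply, Finsupp.sum_fintype _ _ (by simp)] at this
    simpa using this
  have : ∏ i : Fin (n + 1),
      (if (i : ℕ) < h then X i₀ * C (Ideal.Quotient.mk q (X i)) else X i) ^ u i
      = X i₀ ^ d * C (∏ i, (Ideal.Quotient.mk q (X i)) ^ u i) := by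
    rw [← hd, ← Finset.prod_pow_eq_pow_sum, map_prod, ← Finset.prod_mul_distrib]
    refine Finset.prod_congr rfl fun i _ => ?_
    by_cases hi : u i = 0
    · simp [hi]
    · simp [hs u hu' i hi, mul_pow]
  rw [this, map_mul]
  rw [MvPolynomial.algebraMap_apply]
  ring

lemma ker_theta_le {n h : ℕ} (q : Ideal (MvPolynomial (Fin (n + 1)) k)) [q.IsPrime]
    (i₀ : Fin (n + 1)) (hi₀ : (i₀ : ℕ) < h) :
    RingHom.ker (thetaMap h q i₀) ≤ varIdeal k h := by
  intro f hf
  let π : MvPolynomial (Fin (n + 1)) k →ₐ[k] MvPolynomial (Fin (n + 1)) k :=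
    aeval fun j => if (j : ℕ) < h then 0 else X j
  let ρ : MvPolynomial (Fin (n + 1)) (MvPolynomial (Fin (n + 1)) k ⧸ q) →ₐ[
      MvPolynomial (Fin (n + 1)) k ⧸ q] MvPolynomial (Fin (n + 1)) (MvPolynomial (Fin (n + 1)) k ⧸ q) :=
    aeval fun j => if (j : ℕ) < h then 0 else X j
  have h1 : (ρ.restrictScalars k).comp (thetaMap h q i₀) =
      (mapAlgHom (Algebra.ofId k (MvPolynomial (Fin (n + 1)) k ⧸ q))).comp π := by
    apply MvPolynomial.algHom_ext
    intro j
    by_cases hj : (j : ℕ) < h <;> simp [ρ, π, thetaMap, hj, hi₀]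
  have h2 : π f = 0 := by
    have := DFunLike.congr_fun h1 f
    simp only [AlgHom.comp_apply] at this
    rw [RingHom.mem_ker] at hf
    erw [hf] at this
    simp only [map_zero] at this
    have inj : Function.Injective (mapAlgHom (σ := Fin (n + 1)) (Algebra.ofId k (MvPolynomial (Fin (n + 1)) k ⧸ q))) :=
      MvPolynomial.map_injective _ (FaithfulSMul.algebraMap_injective _ _)
    exact inj (this.symm.trans (map_zero _).symm)
  have h3 : ∀ g, g - π g ∈ (varIdeal k h : Ideal (MvPolynomial (Fin (n + 1)) k)) := by
    intro g
    rw [← Ideal.Quotient.eq]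
    have : (Ideal.Quotient.mkₐ k (varIdeal k h)) = (Ideal.Quotient.mkₐ k (varIdeal k h)).comp π := by
      apply MvPolynomial.algHom_ext
      intro j
      by_cases hj : (j : ℕ) < h
      · simp [π, hj, Ideal.Quotient.eq_zero_iff_mem, X_mem_varIdeal hj]
      · simp [π, hj]
    exact DFunLike.congr_fun this g
  simpa [h2] using h3 f

lemma varIdeal_prime {n h : ℕ} : (varIdeal k h : Ideal (MvPolynomial (Fin (n + 1)) k)).IsPrime := by
  rw [Ideal.isPrime_iff]
  have key : ∀ f, f ∈ (varIdeal k h : Ideal (MvPolynomial (Fin (n + 1)) k)) ↔ wo h f ≠ 0 := by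
    intro f
    rw [← pow_one (varIdeal k h), varIdeal_pow, mem_woIdeal, Nat.cast_one, Order.one_le_iff_pos,
      pos_iff_ne_zero]
  refine ⟨?_, ?_⟩
  · rw [Ideal.ne_top_iff_one, key, wo_one]; simp
  · intro x y
    simp only [key, wo_mul]
    intro hxy
    by_contra! hc
    simp [hc] at hxy

lemma height_varIdeal_le {n h : ℕ} :
    (varIdeal k h : Ideal (MvPolynomial (Fin (n + 1)) k)).height ≤ h := by
  have := varIdeal_prime (k := k) (n := n) (h := h)
  classical
  let T : Finset (MvPolynomial (Fin (n + 1)) k) := (Finset.range h).image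
    (fun j => if hj : j < n + 1 then X (⟨j, hj⟩ : Fin (n + 1)) else 0)
  have heq : (varIdeal k h : Ideal (MvPolynomial (Fin (n + 1)) k)) = Ideal.span T := by
    apply le_antisymm
    · refine Ideal.span_mono ?_
      rintro _ ⟨i, hi, rfl⟩
      simp only [T, Finset.coe_image, Set.mem_image, Finset.coe_range, Set.mem_Iio]
      exact ⟨i, hi, dif_pos i.2⟩
    · rw [Ideal.span_le]
      intro x hx
      simp only [T, Finset.coe_image, Set.mem_image, Finset.coe_range, Set.mem_Iio] at hx
      obtain ⟨j, hj, rfl⟩ := hx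
      split_ifs
      · exact X_mem_varIdeal hj
      · exact zero_mem _
  have h1 := Ideal.height_le_card_of_mem_minimalPrimes_span_finset
    (p := (varIdeal k h : Ideal (MvPolynomial (Fin (n + 1)) k))) (s := T)
    (by rw [← heq, Ideal.minimalPrimes_eq_subsingleton_self]; rfl)
  refine h1.trans ?_
  exact_mod_cast (Finset.card_image_le.trans (by simp))

lemma le_radical {n d h : ℕ} (I : Ideal (MvPolynomial (Fin (n + 1)) k))
    (S : Set (MvPolynomial (Fin (n + 1)) k)) (hgen : I = Ideal.span S)
    (hhom : ∀ f ∈ S, f.IsHomogeneous d) (hh : (h : ℕ∞) ≤ I.height)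
    (hI : I ≤ (varIdeal k h) ^ d) : varIdeal k h ≤ I.radical := by
  rw [Ideal.radical_eq_sInf]
  refine le_sInf ?_
  rintro q ⟨hIq, hq⟩
  rw [varIdeal, Ideal.span_le]
  rintro _ ⟨i, hi, rfl⟩
  by_contra hiq
  have := varIdeal_prime (k := k) (n := n) (h := h)
  have hP : (RingHom.ker (thetaMap h q i)).IsPrime := RingHom.ker_isPrime _
  have hle := ker_theta_le q i hi
  have hlt : RingHom.ker (thetaMap h q i) < varIdeal k h := by
    refine lt_of_le_of_ne hle fun he => hiq ?_
    have h1 := X_mem_varIdeal (k := k) hi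
    rw [← he, RingHom.mem_ker] at h1
    simp only [thetaMap, aeval_X, hi, if_true] at h1
    rw [mul_eq_zero, or_iff_right (X_ne_zero _), C_eq_zero, Ideal.Quotient.eq_zero_iff_mem] at h1
    exact h1
  have hIP : I ≤ RingHom.ker (thetaMap h q i) := by
    rw [hgen, Ideal.span_le]
    intro f hf
    have hfI : f ∈ I := hgen ▸ Ideal.subset_span hf
    rw [SetLike.mem_coe, RingHom.mem_ker]
    have h2 : thetaMap h q i f = _ := theta_homog q i (hhom f hf) (hI hfI)
    have h3 : Ideal.Quotient.mk q f = 0 := Ideal.Quotient.eq_zero_iff_mem.2 (hIq hfI)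
    rw [h2, h3]
    simp
  have h4 := Ideal.height_add_one_le_of_lt_of_isPrime hlt
  have h5 := (add_le_add_left (hh.trans (Ideal.height_mono hIP)) 1).trans (h4.trans height_varIdeal_le)
  norm_cast at h5
  omega

lemma reduction_aux {n d h c : ℕ} (I : Ideal (MvPolynomial (Fin (n + 1)) k))
    (S : Set (MvPolynomial (Fin (n + 1)) k)) (hgen : I = Ideal.span S)
    (hhom : ∀ f ∈ S, IsWeightedHomogeneous (wt n h) f d) (g : MvPolynomial (Fin (n + 1)) k)
    (hg : g ∈ I) : ∀ a, ∃ b ∈ I * (varIdeal k h) ^ c,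
      ∀ u, coeff u (a * g - b) ≠ 0 → Finsupp.weight (wt n h) u < c + d := by
  have hadd : ∀ x y : MvPolynomial (Fin (n + 1)) k,
      (∃ b ∈ I * (varIdeal k h) ^ c,
        ∀ u, coeff u (x - b) ≠ 0 → Finsupp.weight (wt n h) u < c + d) →
      (∃ b ∈ I * (varIdeal k h) ^ c,
        ∀ u, coeff u (y - b) ≠ 0 → Finsupp.weight (wt n h) u < c + d) →
      (∃ b ∈ I * (varIdeal k h) ^ c,
        ∀ u, coeff u (x + y - b) ≠ 0 → Finsupp.weight (wt n h) u < c + d) := by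
    rintro x y ⟨b, hb, h1⟩ ⟨b', hb', h2⟩
    refine ⟨b + b', add_mem hb hb', fun u hu => ?_⟩
    by_cases h3 : coeff u (x - b) = 0
    · apply h2 u
      rw [add_sub_add_comm, coeff_add, h3, zero_add] at hu
      exact hu
    · exact h1 u h3
  rw [hgen] at hg
  induction hg using Submodule.span_induction with
  | mem s hs =>
    intro a
    induction a using MvPolynomial.induction_on' with
    | monomial v r =>
      by_cases hv : c ≤ Finsupp.weight (wt n h) v
      · refine ⟨monomial v r * s, ?_, by simp⟩
        rw [mul_comm (monomial v r) s]
        refine Ideal.mul_mem_mul (hgen ▸ Ideal.subset_span hs) (mem_varIdeal_pow.2 fun u hu => ?_)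
        have : v = u := by
          by_contra hne
          rw [coeff_monomial, if_neg hne] at hu
          exact hu rfl
        exact this ▸ hv
      · refine ⟨0, zero_mem _, fun u hu => ?_⟩
        rw [sub_zero] at hu
        have := ((isWeightedHomogeneous_monomial (wt n h) v r rfl).mul (hhom s hs)) hu
        omega
    | add p q hp hq => rw [add_mul]; exact hadd _ _ hp hq
  | zero => intro a; exact ⟨0, zero_mem _, by simp⟩
  | add x y _ _ hx hy => intro a; rw [mul_add]; exact hadd _ _ (hx a) (hy a)
  | smul r x _ hx => intro a; rw [smul_eq_mul, ← mul_assoc]; exact hx _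

lemma reduction {n d h c : ℕ} (I : Ideal (MvPolynomial (Fin (n + 1)) k))
    (S : Set (MvPolynomial (Fin (n + 1)) k)) (hgen : I = Ideal.span S)
    (hhom : ∀ f ∈ S, IsWeightedHomogeneous (wt n h) f d) (hI : I ≤ (varIdeal k h) ^ d)
    (hc : (varIdeal k h) ^ c ≤ I) : (varIdeal k h) ^ (c + d) ≤ I * (varIdeal k h) ^ c := by
  intro f hf
  obtain ⟨b, hb, hw⟩ := reduction_aux (c := c) I S hgen hhom f
    (hc (Ideal.pow_le_pow_right (by omega) hf)) 1
  rw [one_mul] at hw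
  have h1 : f - b ∈ (varIdeal k h : Ideal (MvPolynomial (Fin (n + 1)) k)) ^ (c + d) := by
    refine sub_mem hf ?_
    rw [add_comm c d, pow_add]
    exact Ideal.mul_mono_left hI hb
  rw [mem_varIdeal_pow] at h1
  have : f - b = 0 := by
    ext u
    by_contra hu
    rw [coeff_zero] at hu
    have := h1 u hu
    have := hw u hu
    omega
  rw [sub_eq_zero.1 this]
  exact hb

lemma intCl_eq {n d h : ℕ} (hd : 0 < d) (I : Ideal (MvPolynomial (Fin (n + 1)) k)) (hI0 : I ≠ ⊥)
    (S : Set (MvPolynomial (Fin (n + 1)) k)) (hgen : I = Ideal.span S)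
    (hhom : ∀ f ∈ S, f.IsHomogeneous d) (hh : (h : ℕ∞) ≤ I.height)
    (hI : I ≤ (varIdeal k h) ^ d) :
    intCl I = (((varIdeal k h : Ideal (MvPolynomial (Fin (n + 1)) k)) ^ d :
      Ideal (MvPolynomial (Fin (n + 1)) k)) : Set (MvPolynomial (Fin (n + 1)) k)) := by
  apply Set.Subset.antisymm
  · intro x hx
    exact intCl_subset I hI hx
  · intro x hx
    obtain ⟨c, hc⟩ := Ideal.exists_pow_le_of_le_radical_of_fg (le_radical I S hgen hhom hh hI)
      (IsNoetherian.noetherian _)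
    have hm : (varIdeal k h : Ideal (MvPolynomial (Fin (n + 1)) k)) ≠ ⊥ := by
      intro h0
      rw [h0, ← Ideal.zero_eq_bot, zero_pow hd.ne'] at hI
      exact hI0 (le_bot_iff.1 hI)
    refine intCl_of_mul I ((varIdeal k h) ^ c) (pow_ne_zero _ hm) x fun y hy => ?_
    refine reduction I S hgen (fun f hf => (homog_weight (hhom f hf)
      (hI (hgen ▸ Ideal.subset_span hf))).2) hI hc ?_
    rw [add_comm c d, pow_add]
    exact Ideal.mul_mem_mul hx hy

lemma subset_intCl {R : Type*} [CommRing R] (I : Ideal R) : (I : Set R) ⊆ intCl I := by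
  intro x hx
  refine ⟨1, one_pos, fun _ => -x, ?_, by simp⟩
  intro i hi
  obtain rfl : i = 1 := by simpa using hi
  simpa using hx

lemma coordChange_comp {n : ℕ} (M N : Matrix (Fin (n + 1)) (Fin (n + 1)) k) :
    (coordChange M).comp (coordChange N) = coordChange (N * M) := by
  apply MvPolynomial.algHom_ext
  intro i
  simp only [coordChange, AlgHom.comp_apply, aeval_X, map_sum, map_mul, Matrix.mul_apply,
    Finset.sum_mul, Finset.mul_sum, algHom_C]
  rw [Finset.sum_comm]
  simp [mul_assoc, MvPolynomial.algebraMap_eq]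

lemma coordChange_one {n : ℕ} :
    coordChange (1 : Matrix (Fin (n + 1)) (Fin (n + 1)) k) = AlgHom.id k _ := by
  apply MvPolynomial.algHom_ext
  intro i
  simp [coordChange, Matrix.one_apply, apply_ite (C : k → MvPolynomial (Fin (n + 1)) k), ite_mul]

/-- coordinate change as an equivalence -/
def coordEquiv {n : ℕ} (M : Matrix (Fin (n + 1)) (Fin (n + 1)) k) (hM : IsUnit M.det) :
    MvPolynomial (Fin (n + 1)) k ≃ₐ[k] MvPolynomial (Fin (n + 1)) k :=
  AlgEquiv.ofAlgHom (coordChange M) (coordChange M⁻¹)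
    (by rw [coordChange_comp, Matrix.nonsing_inv_mul _ hM, coordChange_one])
    (by rw [coordChange_comp, Matrix.mul_nonsing_inv _ hM, coordChange_one])

lemma height_coordChange {n : ℕ} (M : Matrix (Fin (n + 1)) (Fin (n + 1)) k) (hM : IsUnit M.det)
    (I : Ideal (MvPolynomial (Fin (n + 1)) k)) : (I.map (coordChange M)).height = I.height :=
  RingEquiv.height_map (coordEquiv M hM).toRingEquiv I

lemma coordChange_inv {n : ℕ} (M : Matrix (Fin (n + 1)) (Fin (n + 1)) k) (hM : IsUnit M.det)
    (f : MvPolynomial (Fin (n + 1)) k) : coordChange M⁻¹ (coordChange M f) = f :=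
  (coordEquiv M hM).symm_apply_apply f

lemma coordChange_homog {n d : ℕ} (M : Matrix (Fin (n + 1)) (Fin (n + 1)) k)
    {f : MvPolynomial (Fin (n + 1)) k} (hf : f.IsHomogeneous d) :
    (coordChange M f).IsHomogeneous d := by
  have := hf.aeval (fun i => ∑ j, MvPolynomial.C (M i j) * X j) (n := 1) (fun i => by
    refine IsHomogeneous.sum _ _ _ fun j _ => ?_
    simpa using (isHomogeneous_C _ (M i j)).mul (isHomogeneous_X k j))
  rwa [one_mul] at this

lemma exists_matrix {N h r : ℕ} (hN : N = h + r) (c : Matrix (Fin h) (Fin N) k) :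
    ∃ M : Matrix (Fin N) (Fin N) k, IsUnit M.det ∧ ∀ (i : Fin h) (l : Fin N), h ≤ (l : ℕ) → (c * M) i l = 0 := by
  subst hN
  have hr : r ≤ Module.finrank k (LinearMap.ker c.mulVecLin) := by
    have h1 := LinearMap.finrank_range_add_finrank_ker c.mulVecLin
    have h2 := Submodule.finrank_le (LinearMap.range c.mulVecLin)
    simp at h1 h2
    omega
  obtain ⟨v, hv⟩ := exists_linearIndependent_of_le_finrank hr
  have hw : LinearIndependent k (fun i => (v i : Fin (h + r) → k)) :=
    hv.map' (Submodule.subtype _) (Submodule.ker_subtype _)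
  let b := Module.Basis.sumExtend hw
  have hb : ∀ j, b (Sum.inl j) = v j := fun j => by
    simp only [b, Module.Basis.sumExtend, Module.Basis.reindex_apply, Module.Basis.coe_extend]
    rfl
  have : Finite (Fin r ⊕ Module.Basis.sumExtendIndex hw) := Module.Finite.finite_basis b
  have : Finite (Module.Basis.sumExtendIndex hw) := Finite.sum_right (Fin r)
  have : Fintype (Module.Basis.sumExtendIndex hw) := Fintype.ofFinite _
  have hcard : Fintype.card (Module.Basis.sumExtendIndex hw) = h := by
    have := Module.finrank_eq_card_basis b
    simp at this
    simp
    omega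
  let σ : Fin r ⊕ Module.Basis.sumExtendIndex hw ≃ Fin (h + r) :=
    ((Equiv.sumComm _ _).trans (Equiv.sumCongr (Fintype.equivFinOfCardEq hcard) (Equiv.refl _))).trans
      finSumFinEquiv
  let b' := b.reindex σ
  have hb' : ∀ j : Fin r, b' (Fin.natAdd h j) = v j := by
    intro j
    have : σ (Sum.inl j) = Fin.natAdd h j := by simp [σ]
    rw [← this]
    simp [b', hb]
  refine ⟨Matrix.of fun j l => b' l j, ?_, ?_⟩
  · rw [← Matrix.isUnit_iff_isUnit_det, ← Matrix.linearIndependent_cols_iff_isUnit]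
    exact b'.linearIndependent
  · intro i l hl
    obtain ⟨j, rfl⟩ : ∃ j : Fin r, l = Fin.natAdd h j :=
      ⟨⟨l - h, by omega⟩, by ext; simp; omega⟩
    have := (v j).2
    rw [LinearMap.mem_ker, Matrix.mulVecLin_apply, ← hb'] at this
    exact congrFun this i

lemma exists_coord {n h : ℕ} (ℓ : Fin h → MvPolynomial (Fin (n + 1)) k)
    (hℓ : ∀ i, (ℓ i).IsHomogeneous 1) : ∃ M : Matrix (Fin (n + 1)) (Fin (n + 1)) k,
      IsUnit M.det ∧ ∀ i, coordChange M (ℓ i) ∈ supported k {j : Fin (n + 1) | (j : ℕ) < h} := by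
  by_cases hn : n + 1 ≤ h
  · refine ⟨1, by simp, fun i => ?_⟩
    have : {j : Fin (n + 1) | (j : ℕ) < h} = Set.univ := by ext j; simp; omega
    rw [this]; simp
  have hex : ∀ i, ∃ c : Fin (n + 1) → k, ℓ i = ∑ j, c j • X j := by
    intro i
    have := hℓ i
    rw [← mem_homogeneousSubmodule, homogeneousSubmodule_one_eq_span_X,
      Submodule.mem_span_range_iff_exists_fun] at this
    obtain ⟨c, hc⟩ := this
    exact ⟨c, hc.symm⟩
  choose c hc using hex
  obtain ⟨M, hM, h0⟩ := exists_matrix (N := n + 1) (h := h) (r := n + 1 - h) (by omega) (Matrix.of c)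
  refine ⟨M, hM, fun i => ?_⟩
  have : coordChange M (ℓ i) = ∑ l, C ((Matrix.of c * M) i l) * X l := by
    rw [hc]
    simp only [coordChange, map_sum, aeval_X, Matrix.mul_apply, Finset.sum_mul,
      smul_eq_C_mul, map_mul]
    rw [Finset.sum_comm]
    simp [mul_assoc, Finset.mul_sum]
  rw [this]
  refine sum_mem fun l _ => ?_
  by_cases hl : (l : ℕ) < h
  · exact mul_mem (Subalgebra.algebraMap_mem _ _) (X_mem_supported.2 hl)
  · rw [h0 i l (by omega)]; simp

lemma supported_weight {n h : ℕ} {f : MvPolynomial (Fin (n + 1)) k}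
    (hf : f ∈ supported k {j : Fin (n + 1) | (j : ℕ) < h}) (u) (hu : coeff u f ≠ 0) :
    Finsupp.weight (wt n (n + 1)) u = Finsupp.weight (wt n h) u := by
  rw [Finsupp.weight_apply, Finsupp.weight_apply]
  refine Finsupp.sum_congr fun i hi => ?_
  have : (i : ℕ) < h := (mem_supported.1 hf) ((mem_vars_iff_mem_support i).2 ⟨u, by simpa using hu, hi⟩)
  simp only [wt, this, i.2, if_true]

lemma homog_mem {n d : ℕ} {f : MvPolynomial (Fin (n + 1)) k} (hf : f.IsHomogeneous d) :
    f ∈ (varIdeal k (n + 1) : Ideal (MvPolynomial (Fin (n + 1)) k)) ^ d := by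
  rw [mem_varIdeal_pow]
  intro u hu
  rw [← hf hu]
  apply le_of_eq
  rw [Finsupp.weight_apply, Finsupp.weight_apply]
  refine Finsupp.sum_congr fun i hi => ?_
  simp only [wt, i.2, if_true, Pi.one_apply]

lemma ess_le_of {n d h : ℕ} (I : Ideal (MvPolynomial (Fin (n + 1)) k))
    (S : Set (MvPolynomial (Fin (n + 1)) k)) (hgen : I = Ideal.span S)
    (hhom : ∀ f ∈ S, f.IsHomogeneous d)
    (M : Matrix (Fin (n + 1)) (Fin (n + 1)) k) (hM : IsUnit M.det)
    (hI : I.map (coordChange M) ≤ (varIdeal k h) ^ d) : essCodim I ≤ h := by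
  let ℓ : Fin h → MvPolynomial (Fin (n + 1)) k := fun j =>
    if hj : (j : ℕ) < n + 1 then coordChange M⁻¹ (X ⟨j, hj⟩) else 0
  refine Nat.sInf_le ⟨ℓ, ?_, S, ?_, hgen⟩
  · intro i
    dsimp only [ℓ]
    split_ifs
    · exact coordChange_homog _ (isHomogeneous_X _ _)
    · exact isHomogeneous_zero _ _ _
  · intro f hf
    have h1 : coordChange M f ∈ (varIdeal k h : Ideal (MvPolynomial (Fin (n + 1)) k)) ^ d :=
      hI (Ideal.mem_map_of_mem _ (hgen ▸ Ideal.subset_span hf))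
    have h2 := (homog_weight (coordChange_homog M (hhom f hf)) h1).1
    have h3 : coordChange M f ∈ supported k {j : Fin (n + 1) | (j : ℕ) < h} := by
      rw [mem_supported]
      intro i hi
      obtain ⟨u, hu, hui⟩ := (mem_vars_iff_mem_support i).1 hi
      exact h2 u (by simpa using hu) i (by simpa using hui)
    have h4 : coordChange M⁻¹ (coordChange M f) ∈
        (supported k {j : Fin (n + 1) | (j : ℕ) < h}).map (coordChange M⁻¹) := ⟨_, h3, rfl⟩
    rw [coordChange_inv M hM, supported, AlgHom.map_adjoin] at h4
    refine Algebra.adjoin_mono ?_ h4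
    rintro _ ⟨_, ⟨j, hj, rfl⟩, rfl⟩
    exact ⟨⟨j, hj⟩, dif_pos j.2⟩

lemma le_ess_of {n d h : ℕ} (hd : 0 < d) (I : Ideal (MvPolynomial (Fin (n + 1)) k))
    (S : Set (MvPolynomial (Fin (n + 1)) k)) (hgen : I = Ideal.span S)
    (hhom : ∀ f ∈ S, f.IsHomogeneous d) (hh : (h : ℕ∞) ≤ I.height) : h ≤ essCodim I := by
  refine le_csInf ⟨n + 1, X, fun i => isHomogeneous_X _ _, S, ?_, hgen⟩ ?_
  · rw [MvPolynomial.adjoin_range_X]; exact fun _ _ => trivial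
  · rintro r ⟨ℓ, hℓ, S', hS', hgen'⟩
    have hle : Ideal.span (Set.range ℓ) ≤ RingHom.ker (constantCoeff (R := k) (σ := Fin (n + 1))) := by
      rw [Ideal.span_le]
      rintro _ ⟨i, rfl⟩
      rw [SetLike.mem_coe, RingHom.mem_ker]
      exact (hℓ i).coeff_eq_zero (by simp)
    have hI0 : I ≤ RingHom.ker (constantCoeff (R := k) (σ := Fin (n + 1))) := by
      rw [hgen, Ideal.span_le]
      intro f hf
      rw [SetLike.mem_coe, RingHom.mem_ker]
      exact (hhom f hf).coeff_eq_zero (by simp; omega)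
    have hsub : I ≤ Ideal.span (Set.range ℓ) := by
      rw [hgen', Ideal.span_le]
      intro s hs
      have hA : Algebra.adjoin k (Set.range ℓ) ≤
          (⊥ : Subalgebra k (MvPolynomial (Fin (n + 1)) k ⧸ Ideal.span (Set.range ℓ))).comap
            (Ideal.Quotient.mkₐ k (Ideal.span (Set.range ℓ))) := by
        rw [Algebra.adjoin_le_iff]
        rintro _ ⟨i, rfl⟩
        have : Ideal.Quotient.mk (Ideal.span (Set.range ℓ)) (ℓ i) = 0 :=
          Ideal.Quotient.eq_zero_iff_mem.2 (Ideal.subset_span ⟨i, rfl⟩)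
        simp only [SetLike.mem_coe, Subalgebra.mem_comap, Ideal.Quotient.mkₐ_eq_mk, this]
        exact zero_mem _
      obtain ⟨c, hc⟩ := Algebra.mem_bot.1 (hA (hS' hs))
      have h1 : s - C c ∈ Ideal.span (Set.range ℓ) := by
        rw [← Ideal.Quotient.eq]; exact hc.symm
      have h2 := hle h1
      have h3 := hI0 (hgen' ▸ Ideal.subset_span hs : s ∈ I)
      rw [RingHom.mem_ker] at h2 h3
      have h4 : c = 0 := by simpa [h3] using h2
      simpa [h4] using h1
    have hne : Ideal.span (Set.range ℓ) ≠ ⊤ := by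
      intro h0
      rw [h0, top_le_iff] at hle
      exact RingHom.ker_ne_top _ hle
    have h5 := Ideal.height_le_spanFinrank _ hne
    have h6 := Submodule.spanFinrank_span_le_ncard_of_finite (R := MvPolynomial (Fin (n + 1)) k)
      (Set.finite_range ℓ)
    have h7 : (Set.range ℓ).ncard ≤ r := by
      rw [← Set.image_univ]
      exact (Set.ncard_image_le Set.finite_univ).trans (by simp [Set.ncard_univ])
    have h8 := (hh.trans (Ideal.height_mono hsub)).trans h5
    have h9 : h ≤ (Ideal.span (Set.range ℓ)).spanFinrank := by exact_mod_cast h8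
    exact h9.trans (h6.trans h7)

lemma of_ess {n d h : ℕ} (I : Ideal (MvPolynomial (Fin (n + 1)) k))
    (S : Set (MvPolynomial (Fin (n + 1)) k)) (hgen : I = Ideal.span S)
    (hhom : ∀ f ∈ S, f.IsHomogeneous d) (he : essCodim I = h) :
    ∃ M : Matrix (Fin (n + 1)) (Fin (n + 1)) k, IsUnit M.det ∧
        I.map (coordChange M) ≤ (varIdeal k h : Ideal (MvPolynomial (Fin (n + 1)) k)) ^ d := by
  have hmem := Nat.sInf_mem (s := {r : ℕ | ∃ ℓ : Fin r → MvPolynomial (Fin (n + 1)) k,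
    (∀ i, (ℓ i).IsHomogeneous 1) ∧
    ∃ S : Set (MvPolynomial (Fin (n + 1)) k),
      S ⊆ (Algebra.adjoin k (Set.range ℓ) : Subalgebra k (MvPolynomial (Fin (n + 1)) k)) ∧
      I = Ideal.span S}) ⟨n + 1, X, fun i => isHomogeneous_X _ _, S, by
        rw [MvPolynomial.adjoin_range_X]; exact fun _ _ => trivial, hgen⟩
  change essCodim I ∈ _ at hmem
  rw [he] at hmem
  obtain ⟨ℓ, hℓ, S', hS', hgen'⟩ := hmem
  obtain ⟨M, hM, hMℓ⟩ := exists_coord ℓ hℓ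
  refine ⟨M, hM, ?_⟩
  have hle : I.map (coordChange M) ≤ (varIdeal k (n + 1)) ^ d := by
    rw [hgen, Ideal.map_span, Ideal.span_le]
    rintro _ ⟨f, hf, rfl⟩
    exact homog_mem (coordChange_homog M (hhom f hf))
  conv_lhs => rw [hgen']
  rw [Ideal.map_span, Ideal.span_le]
  rintro _ ⟨s, hs, rfl⟩
  have h1 : coordChange M s ∈ supported k {j : Fin (n + 1) | (j : ℕ) < h} := by
    have : Algebra.adjoin k (Set.range ℓ) ≤
        (supported k {j : Fin (n + 1) | (j : ℕ) < h}).comap (coordChange M) := by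
      rw [Algebra.adjoin_le_iff]
      rintro _ ⟨i, rfl⟩
      exact hMℓ i
    exact this (hS' hs)
  have h2 := hle (Ideal.mem_map_of_mem (coordChange M) (hgen' ▸ Ideal.subset_span hs : s ∈ I))
  rw [mem_varIdeal_pow] at h2
  refine mem_varIdeal_pow.2 fun u hu => ?_
  rw [← supported_weight h1 u hu]
  exact h2 u hu

theorem stmt16 {n d h : ℕ} {p : ℕ} (hp : p.Prime) [CharP k p] [IsAlgClosed k]
    (I : Ideal (MvPolynomial (Fin (n + 1)) k)) (hI : I ≠ ⊥)
    (S : Set (MvPolynomial (Fin (n + 1)) k)) (hgen : I = Ideal.span S)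
    (hhom : ∀ f ∈ S, f.IsHomogeneous d) (hd : 0 < d)
    (hh : idealHeight I = (h : ℕ∞)) :
    (essCodim I = h ↔
      ∃ M : Matrix (Fin (n + 1)) (Fin (n + 1)) k, IsUnit M.det ∧
        intCl (I.map (coordChange M)) = (((varIdeal k h : Ideal (MvPolynomial (Fin (n + 1)) k)) ^ d : Ideal (MvPolynomial (Fin (n + 1)) k)) : Set (MvPolynomial (Fin (n + 1)) k))) ∧
    (essCodim I = h ↔
      ∃ M : Matrix (Fin (n + 1)) (Fin (n + 1)) k, IsUnit M.det ∧
        I.map (coordChange M) ≤ (varIdeal k h : Ideal (MvPolynomial (Fin (n + 1)) k)) ^ d) := by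

  rw [idealHeight_eq] at hh
  have h13 : essCodim I = h ↔
      ∃ M : Matrix (Fin (n + 1)) (Fin (n + 1)) k, IsUnit M.det ∧
        I.map (coordChange M) ≤
          (varIdeal k h : Ideal (MvPolynomial (Fin (n + 1)) k)) ^ d := by
    constructor
    · exact of_ess I S hgen hhom
    · rintro ⟨M, hM, hI'⟩
      exact le_antisymm (ess_le_of I S hgen hhom M hM hI') (le_ess_of hd I S hgen hhom hh.ge)
  refine ⟨?_, h13⟩
  rw [h13]
  constructor
  · rintro ⟨M, hM, hI'⟩
    refine ⟨M, hM, intCl_eq hd _ ?_ (Set.image (coordChange M) S) ?_ ?_ ?_ hI'⟩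
    · intro h0
      apply hI
      exact (Ideal.map_eq_bot_iff_of_injective (coordEquiv M hM).injective).1 h0
    · rw [hgen, Ideal.map_span]
    · rintro _ ⟨f, hf, rfl⟩
      exact coordChange_homog M (hhom f hf)
    · rw [height_coordChange M hM, hh]
  · rintro ⟨M, hM, hI'⟩
    refine ⟨M, hM, fun x hx => ?_⟩
    have := subset_intCl _ hx
    rw [hI'] at this
    exact this
end
end
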